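/- arXiv:2211.07868 — 15 statements merged into one kernel-verified Lean document; each statement's English description precedes it below -/
import Mathlib

section
/- Consider a dynamical system ẋ = F(x,t) with F : ℝⁿ_{≥0} × ℝ_{≥0} → ℝⁿ continuously differentiable and forward-invariant nonnegative orthant, and suppose there exists x_i* > 0 such that for all x in the open positive orthant, F_i(x,t) = 0 if and only if x_i = x_i*. Let (x(t))_{t≥0} be a solution remaining in the positive orthant with x_i(0) ≠ x_i*. Then the quantity F_i(x(t),t)/(x_i* − x_i(t)) is defined for all t ≥ 0 and has the same (nonzero) sign as F_i(x(0),0)/(x_i* − x_i(0)) for all t ≥ 0. -/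
open Filter MeasureTheory Topology

/-- Theorem "zero load", part 2: along a positive solution with
`x_i(0) ≠ x_i*`, the quantity `F_i(x(t),t)/(x_i* − x_i(t))` is defined for all `t ≥ 0`
(i.e. `x_i(t) ≠ x_i*`) and has the same nonzero sign as its value at `t = 0`. -/
theorem stmt1 (n : ℕ) (F : (Fin n → ℝ) → ℝ → (Fin n → ℝ))
    (hF : ContDiffOn ℝ 1 (fun p : (Fin n → ℝ) × ℝ => F p.1 p.2)
      {p : (Fin n → ℝ) × ℝ | (∀ j, 0 ≤ p.1 j) ∧ 0 ≤ p.2})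
    (hinv : ∀ y : ℝ → (Fin n → ℝ), (∀ t ≥ (0:ℝ), HasDerivAt y (F (y t) t) t) →
      (∀ j, 0 ≤ y 0 j) → ∀ t ≥ (0:ℝ), ∀ j, 0 ≤ y t j)
    (i : Fin n) (xs : ℝ) (hxs : 0 < xs)
    (hzero : ∀ z : Fin n → ℝ, (∀ j, 0 < z j) → ∀ t ≥ (0:ℝ), (F z t i = 0 ↔ z i = xs))
    (x : ℝ → (Fin n → ℝ))
    (hsol : ∀ t ≥ (0:ℝ), HasDerivAt x (F (x t) t) t)
    (hpos : ∀ t ≥ (0:ℝ), ∀ j, 0 < x t j)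
    (hne : x 0 i ≠ xs) :
    ∀ t ≥ (0:ℝ), x t i ≠ xs ∧
      F (x t) t i / (xs - x t i) ≠ 0 ∧
      Real.sign (F (x t) t i / (xs - x t i)) =
        Real.sign (F (x 0) 0 i / (xs - x 0 i)) := by
  have hxc : ContinuousOn x (Set.Ici 0) := fun t ht => (hsol t ht).continuousAt.continuousWithinAt
  have hxne : ∀ T ≥ (0:ℝ), x T i ≠ xs := by
    intro T hT hTx
    obtain ⟨M, hM⟩ := (isCompact_Icc (a := (0:ℝ)) (b := T)).exists_bound_of_continuousOn
      (hxc.mono Set.Icc_subset_Ici_self)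
    set B : ℝ := max M xs with hB
    have hxB : ∀ t ∈ Set.Icc (0:ℝ) T, ∀ j, x t j ≤ B := fun t ht j =>
      ((le_abs_self _).trans (norm_le_pi_norm (x t) j)).trans ((hM t ht).trans (le_max_left _ _))
    set S : Set ((Fin n → ℝ) × ℝ) := Set.Icc (fun _ => 0) (fun _ => B) ×ˢ Set.Icc 0 T with hS
    have hsub : S ⊆ {p : (Fin n → ℝ) × ℝ | (∀ j, 0 ≤ p.1 j) ∧ 0 ≤ p.2} :=
      fun p hp => ⟨fun j => hp.1.1 j, hp.2.1⟩
    obtain ⟨K, hK⟩ := (hF.mono hsub).exists_lipschitzOnWith one_ne_zero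
      ((convex_Icc _ _).prod (convex_Icc _ _)) (isCompact_Icc.prod isCompact_Icc)
    have key : ∀ t ∈ Set.Icc (0:ℝ) T, |F (x t) t i| ≤ K * |x t i - xs| := by
      intro t ht
      have hp0 : ∀ j, 0 < Function.update (x t) i xs j := by
        intro j
        by_cases h : j = i
        · subst h; simpa using hxs
        · simpa [h] using hpos t ht.1 j
      have hpB : ∀ j, Function.update (x t) i xs j ≤ B := by
        intro j
        by_cases h : j = i
        · subst h; simp [hB]
        · simpa [h] using hxB t ht j
      have h0 : F (Function.update (x t) i xs) t i = 0 := (hzero _ hp0 t ht.1).2 (by simp)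
      have h1 := hK.dist_le_mul (x t, t) ⟨⟨fun j => (hpos t ht.1 j).le, hxB t ht⟩, ht⟩
        (Function.update (x t) i xs, t) ⟨⟨fun j => (hp0 j).le, hpB⟩, ht⟩
      have h2 := (dist_le_pi_dist (F (x t) t) (F (Function.update (x t) i xs) t) i).trans h1
      rw [h0, Real.dist_eq, sub_zero] at h2
      refine h2.trans (mul_le_mul_of_nonneg_left ?_ K.2)
      rw [Prod.dist_eq, dist_self]
      refine max_le ((dist_pi_le_iff (abs_nonneg _)).2 fun j => ?_) (abs_nonneg _)
      by_cases h : j = i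
      · subst h; simp [Real.dist_eq]
      · simp [h]
    have hd : ∀ s ∈ Set.Icc (0:ℝ) T,
        HasDerivAt (fun s => x (T - s) i - xs) (-(F (x (T - s)) (T - s) i)) s := by
      intro s hs
      have h1 := (hasDerivAt_pi.1 (hsol (T - s) (by linarith [hs.2])) i).sub_const xs
      have h2 := h1.comp s ((hasDerivAt_id s).const_sub T)
      rw [mul_neg_one] at h2
      exact h2
    have hg := norm_le_gronwallBound_of_norm_deriv_right_le (f := fun s => x (T - s) i - xs)
      (f' := fun s => -(F (x (T - s)) (T - s) i)) (δ := 0) (K := K) (ε := 0) (a := 0) (b := T)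
      (fun s hs => (hd s hs).continuousAt.continuousWithinAt)
      (fun s hs => (hd s ⟨hs.1, hs.2.le⟩).hasDerivWithinAt) (by simp [hTx])
      (fun s hs => by
        have := key (T - s) ⟨by linarith [hs.2], by linarith [hs.1]⟩
        simpa using this) T ⟨hT, le_rfl⟩
    rw [gronwallBound_ε0_δ0] at hg
    exact hne (by simpa [sub_eq_zero] using hg)
  have hFne : ∀ t ≥ (0:ℝ), F (x t) t i / (xs - x t i) ≠ 0 := fun t ht =>
    div_ne_zero (fun h => hxne t ht ((hzero _ (hpos t ht) t ht).1 h))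
      (sub_ne_zero.2 (hxne t ht).symm)
  have hc : ContinuousOn (fun t => F (x t) t i / (xs - x t i)) (Set.Ici 0) := by
    have h1 : ContinuousOn (fun t => F (x t) t) (Set.Ici 0) :=
      hF.continuousOn.comp (hxc.prodMk continuousOn_id)
        (fun t ht => ⟨fun j => (hpos t ht j).le, ht⟩)
    exact (continuousOn_pi.1 h1 i).div (continuousOn_const.sub (continuousOn_pi.1 hxc i))
      (fun t ht => sub_ne_zero.2 (hxne t ht).symm)
  intro t ht
  refine ⟨hxne t ht, hFne t ht, ?_⟩
  have hoc := (isPreconnected_Ici.image _ hc).ordConnected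
  have hm0 : F (x 0) 0 i / (xs - x 0 i) ∈
      (fun t => F (x t) t i / (xs - x t i)) '' Set.Ici 0 := ⟨0, Set.mem_Ici.2 le_rfl, rfl⟩
  have hmt : F (x t) t i / (xs - x t i) ∈
      (fun t => F (x t) t i / (xs - x t i)) '' Set.Ici 0 := ⟨t, ht, rfl⟩
  have hn0 : (0:ℝ) ∉ (fun t => F (x t) t i / (xs - x t i)) '' Set.Ici 0 := by
    rintro ⟨s, hs, h⟩
    exact hFne s hs h
  rcases lt_or_gt_of_ne (hFne t ht) with h | h <;>
    rcases lt_or_gt_of_ne (hFne 0 le_rfl) with h' | h'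
  · rw [Real.sign_of_neg h, Real.sign_of_neg h']
  · exact absurd (hoc.out hmt hm0 ⟨h.le, h'.le⟩) hn0
  · exact absurd (hoc.out hm0 hmt ⟨h'.le, h.le⟩) hn0
  · rw [Real.sign_of_pos h, Real.sign_of_pos h']
end

section
/- Consider a dynamical system ẋ = F(x,t) with F : ℝⁿ_{≥0} × ℝ_{≥0} → ℝⁿ continuously differentiable and forward-invariant nonnegative orthant, and suppose there exists x_i* > 0 such that for all x in the open positive orthant, F_i(x,t) = 0 if and only if x_i = x_i*. Let (x(t))_{t≥0} be a solution remaining in the positive orthant with x_i(0) ≠ x_i*. Then for all t ≥ 0, (x_i* − x_i(t))/(x_i* − x_i(0)) = exp(−∫₀ᵗ F_i(x(s),s)/(x_i* − x_i(s)) ds). Consequently: (a) if F_i(x(0),0)/(x_i* − x_i(0)) > 0 then |x_i(t) − x_i*| is strictly decreasing on [0,∞) and lim_{t→∞} |x_i(t) − x_i*| = |x_i(0) − x_i*| · exp(−∫₀^∞ F_i(x(s),s)/(x_i* − x_i(s)) ds); (b) if F_i(x(0),0)/(x_i* − x_i(0)) < 0 then |x_i(t) − x_i*| is strictly increasing on [0,∞).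 -/
open Filter MeasureTheory Topology

/-- A continuous nonvanishing function on `[0,∞)` that starts positive stays positive. -/
lemma pos_of_ne_zero_aux (h : ℝ → ℝ) (hc : ContinuousOn h (Set.Ici 0))
    (hn : ∀ t ≥ (0:ℝ), h t ≠ 0) (h0 : 0 < h 0) : ∀ t ≥ (0:ℝ), 0 < h t := by
  intro t ht
  by_contra hlt
  push Not at hlt
  obtain ⟨s, hs, hs0⟩ := (isPreconnected_Ici (a := (0:ℝ))).intermediate_value
    (Set.mem_Ici.2 ht) (Set.mem_Ici.2 le_rfl) hc (show (0:ℝ) ∈ Set.Icc (h t) (h 0) from ⟨hlt, h0.le⟩)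
  exact hn s hs hs0

/-- Local linear bound of `u'` by `u` at every time prevents `u` from reaching zero. -/
lemma ne_zero_of_local_bound_aux (u u' : ℝ → ℝ) (hu : ∀ t ≥ (0:ℝ), HasDerivAt u (u' t) t)
    (hb : ∀ T > (0:ℝ), u T = 0 → ∃ K : ℝ, ∃ δ > 0, ∀ s, 0 ≤ s → |s - T| < δ → |u' s| ≤ K * |u s|)
    (h0 : u 0 ≠ 0) : ∀ t ≥ (0:ℝ), u t ≠ 0 := by
  intro t ht hz
  have hc : ContinuousOn u (Set.Ici 0) := fun t ht => (hu t ht).continuousAt.continuousWithinAt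
  set Z : Set ℝ := Set.Ici 0 ∩ u ⁻¹' {0} with hZ
  have hcl : IsClosed Z := hc.preimage_isClosed_of_isClosed isClosed_Ici isClosed_singleton
  have hbd : BddBelow Z := ⟨0, fun y hy => hy.1⟩
  have hT : sInf Z ∈ Z := hcl.csInf_mem ⟨t, ht, hz⟩ hbd
  set T := sInf Z with hTdef
  have hT0 : 0 ≤ T := hT.1
  have huT : u T = 0 := hT.2
  have hTpos : 0 < T := lt_of_le_of_ne hT0 (fun h => h0 (h ▸ huT))
  obtain ⟨K, δ, hδ, hK⟩ := hb T hTpos huT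
  set e := min (δ / 2) T with he
  have he0 : 0 < e := lt_min (by linarith) hTpos
  have heT : e ≤ T := min_le_right _ _
  have heδ : e ≤ δ / 2 := min_le_left _ _
  have hv : ∀ s ≤ T, HasDerivAt (fun s => u (T - s)) (-u' (T - s)) s := fun s hs => by
    have := (hu (T - s) (by simpa using hs)).comp_const_sub T s
    simpa using this
  have key := eq_zero_of_abs_deriv_le_mul_abs_self_of_eq_zero_right
    (f := fun s => u (T - s)) (f' := fun s => -u' (T - s)) (K := K) (a := 0) (b := e)
    (fun s hs => (hv s (hs.2.trans heT)).continuousAt.continuousWithinAt)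
    (fun s hs => (hv s (hs.2.le.trans heT)).hasDerivWithinAt)
    (by simpa using huT)
    (fun s hs => by
      have := hK (T - s) (by linarith [hs.2]) (by
        rw [abs_lt]; constructor <;> linarith [hs.1, hs.2])
      simpa using this)
  have h1 := key e ⟨he0.le, le_rfl⟩
  have h2 : T ≤ T - e := csInf_le hbd ⟨by simpa using heT, h1⟩
  linarith

/-- Theorem "zero load", part 3: the integral formula
`(x_i* − x_i(t))/(x_i* − x_i(0)) = exp(−∫₀ᵗ F_i(x(s),s)/(x_i* − x_i(s)) ds)` holds,
and consequently, (a) if `F_i(x(0),0)/(x_i* − x_i(0)) > 0` then `|x_i(t) − x_i*|` is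
strictly decreasing on `[0,∞)` with limit `|x_i(0) − x_i*|·exp(−∫₀^∞ …)` (interpreted as
`0` when the integral diverges to `∞`), and (b) if `F_i(x(0),0)/(x_i* − x_i(0)) < 0`
then `|x_i(t) − x_i*|` is strictly increasing on `[0,∞)`. -/
theorem stmt2 (n : ℕ) (F : (Fin n → ℝ) → ℝ → (Fin n → ℝ))
    (hF : ContDiffOn ℝ 1 (fun p : (Fin n → ℝ) × ℝ => F p.1 p.2)
      {p : (Fin n → ℝ) × ℝ | (∀ j, 0 ≤ p.1 j) ∧ 0 ≤ p.2})
    (hinv : ∀ y : ℝ → (Fin n → ℝ), (∀ t ≥ (0:ℝ), HasDerivAt y (F (y t) t) t) →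
      (∀ j, 0 ≤ y 0 j) → ∀ t ≥ (0:ℝ), ∀ j, 0 ≤ y t j)
    (i : Fin n) (xs : ℝ) (hxs : 0 < xs)
    (hzero : ∀ z : Fin n → ℝ, (∀ j, 0 < z j) → ∀ t ≥ (0:ℝ), (F z t i = 0 ↔ z i = xs))
    (x : ℝ → (Fin n → ℝ))
    (hsol : ∀ t ≥ (0:ℝ), HasDerivAt x (F (x t) t) t)
    (hpos : ∀ t ≥ (0:ℝ), ∀ j, 0 < x t j)
    (hne : x 0 i ≠ xs) :
    (∀ t ≥ (0:ℝ), (xs - x t i) / (xs - x 0 i)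
        = Real.exp (-∫ s in (0:ℝ)..t, F (x s) s i / (xs - x s i))) ∧
    (0 < F (x 0) 0 i / (xs - x 0 i) →
      StrictAntiOn (fun t => |x t i - xs|) (Set.Ici (0:ℝ)) ∧
      (∀ I : ℝ,
        Tendsto (fun t => ∫ s in (0:ℝ)..t, F (x s) s i / (xs - x s i)) atTop (𝓝 I) →
        Tendsto (fun t => |x t i - xs|) atTop (𝓝 (|x 0 i - xs| * Real.exp (-I)))) ∧
      (Tendsto (fun t => ∫ s in (0:ℝ)..t, F (x s) s i / (xs - x s i)) atTop atTop →
        Tendsto (fun t => |x t i - xs|) atTop (𝓝 0))) ∧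
    (F (x 0) 0 i / (xs - x 0 i) < 0 →
      StrictMonoOn (fun t => |x t i - xs|) (Set.Ici (0:ℝ))) := by
  have hxi : ∀ t ≥ (0:ℝ), HasDerivAt (fun t => x t i) (F (x t) t i) t := fun t ht =>
    hasDerivAt_pi.1 (hsol t ht) i
  set S : Set ((Fin n → ℝ) × ℝ) := {p | (∀ j, 0 ≤ p.1 j) ∧ 0 ≤ p.2} with hS
  have hconv : Convex ℝ S := by
    intro p hp q hq a b ha hb _
    refine ⟨fun j => ?_, ?_⟩
    · have h1 := mul_nonneg ha (hp.1 j)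
      have h2 := mul_nonneg hb (hq.1 j)
      simpa using add_nonneg h1 h2
    · have h1 := mul_nonneg ha hp.2
      have h2 := mul_nonneg hb hq.2
      simpa using add_nonneg h1 h2
  have hxS : ∀ t ≥ (0:ℝ), (x t, t) ∈ S := fun t ht => ⟨fun j => (hpos t ht j).le, ht⟩
  -- the solution never reaches `xs`
  have hnz : ∀ t ≥ (0:ℝ), xs - x t i ≠ 0 := by
    refine ne_zero_of_local_bound_aux (fun t => xs - x t i) (fun t => -F (x t) t i)
      (fun t ht => (hxi t ht).const_sub xs) ?_ (sub_ne_zero.2 hne.symm)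
    intro T hT hzT
    have hzT' : x T i = xs := (sub_eq_zero.1 hzT).symm
    obtain ⟨K, V, hV, hL⟩ := (hF (x T, T) (hxS T hT.le)).exists_lipschitzOnWith hconv
    have hc : ContinuousAt x T := (hsol T hT.le).continuousAt
    have hc1 : ContinuousAt (fun s => (x s, s)) T := hc.prodMk continuousAt_id
    have hc2 : ContinuousAt (fun s => (Function.update (x s) i xs, s)) T :=
      (hc.update i continuousAt_const).prodMk continuousAt_id
    have hupd : Function.update (x T) i xs = x T := by
      rw [← hzT', Function.update_eq_self]
    rw [mem_nhdsWithin_iff_eventually] at hV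
    have e1 := hc1.eventually hV
    have hV2 : ∀ᶠ p in 𝓝 (Function.update (x T) i xs, T), p ∈ S → p ∈ V := by
      rw [hupd]; exact hV
    have e2 := hc2.eventually hV2
    obtain ⟨δ, hδ, hball⟩ := Metric.eventually_nhds_iff.1 (e1.and e2)
    refine ⟨K, δ, hδ, fun s hs hsT => ?_⟩
    obtain ⟨m1, m2⟩ := hball (y := s) (by rwa [Real.dist_eq])
    have hup : ∀ j, 0 < Function.update (x s) i xs j := by
      intro j
      by_cases hj : j = i
      · subst hj; simpa using hxs
      · simpa [hj] using hpos s hs j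
    have p1 := m1 (hxS s hs)
    have p2 := m2 ⟨fun j => (hup j).le, hs⟩
    have hd := hL.dist_le_mul _ p1 _ p2
    have hF0 : F (Function.update (x s) i xs) s i = 0 := (hzero _ hup s hs).2 (by simp)
    have hd1 : |F (x s) s i| ≤
        dist (F (x s) s) (F (Function.update (x s) i xs) s) := by
      have := dist_le_pi_dist (F (x s) s) (F (Function.update (x s) i xs) s) i
      rwa [hF0, Real.dist_eq, sub_zero] at this
    have hd2 : dist (x s, s) (Function.update (x s) i xs, s) ≤ |xs - x s i| := by
      rw [Prod.dist_eq]
      refine max_le ((dist_pi_le_iff (abs_nonneg _)).2 fun j => ?_) (by simp)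
      by_cases hj : j = i
      · subst hj; simp [Real.dist_eq, abs_sub_comm]
      · simp [hj]
    rw [abs_neg]
    exact hd1.trans (hd.trans (mul_le_mul_of_nonneg_left hd2 K.2))
  have hxc : ContinuousOn x (Set.Ici 0) := fun t ht =>
    (hsol t ht).continuousAt.continuousWithinAt
  have hic : ContinuousOn (fun t => x t i) (Set.Ici 0) := fun t ht =>
    (hxi t ht).continuousAt.continuousWithinAt
  have hFc : ContinuousOn (fun t => F (x t) t) (Set.Ici 0) :=
    hF.continuousOn.comp (f := fun t => (x t, t)) (hxc.prodMk continuousOn_id) hxS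
  have hFic : ContinuousOn (fun t => F (x t) t i) (Set.Ici 0) :=
    (continuous_apply i).comp_continuousOn hFc
  have hgc : ContinuousOn (fun s => F (x s) s i / (xs - x s i)) (Set.Ici 0) :=
    hFic.div (continuousOn_const.sub hic) hnz
  have hgn : ∀ t ≥ (0:ℝ), F (x t) t i / (xs - x t i) ≠ 0 := fun t ht =>
    div_ne_zero (fun h => hnz t ht (sub_eq_zero.2 ((hzero _ (hpos t ht) t ht).1 h).symm))
      (hnz t ht)
  have hwd : ∀ t ≥ (0:ℝ), HasDerivAt (fun t => (xs - x t i) / (xs - x 0 i))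
      (-F (x t) t i / (xs - x 0 i)) t := fun t ht =>
    ((hxi t ht).const_sub xs).div_const _
  have hwc : ContinuousOn (fun t => (xs - x t i) / (xs - x 0 i)) (Set.Ici 0) := fun t ht =>
    (hwd t ht).continuousAt.continuousWithinAt
  have h00 := hnz 0 le_rfl
  have hwp : ∀ t ≥ (0:ℝ), 0 < (xs - x t i) / (xs - x 0 i) :=
    pos_of_ne_zero_aux _ hwc (fun t ht => div_ne_zero (hnz t ht) h00)
      (by simp only [div_self h00]; exact one_pos)
  have hmain : ∀ t ≥ (0:ℝ), (xs - x t i) / (xs - x 0 i)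
        = Real.exp (-∫ s in (0:ℝ)..t, F (x s) s i / (xs - x s i)) := by
    intro t ht
    have hsub : Set.uIcc 0 t ⊆ Set.Ici (0:ℝ) := by
      rw [Set.uIcc_of_le ht]; exact fun s hs => hs.1
    have hint : IntervalIntegrable (fun s => F (x s) s i / (xs - x s i)) volume 0 t :=
      (hgc.mono hsub).intervalIntegrable
    have := intervalIntegral.integral_eq_sub_of_hasDerivAt
      (f := fun s => -Real.log ((xs - x s i) / (xs - x 0 i)))
      (f' := fun s => F (x s) s i / (xs - x s i)) (a := 0) (b := t)
      (fun s hs => by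
        have hs0 := hsub hs
        have h := ((hwd s hs0).log (hwp s hs0).ne').neg
        refine h.congr_deriv ?_
        have := hnz s hs0
        field_simp) hint
    rw [this, div_self h00, Real.log_one, neg_zero, sub_zero, neg_neg, Real.exp_log (hwp t ht)]
  have habs : ∀ t ≥ (0:ℝ), |x t i - xs| = |x 0 i - xs| * ((xs - x t i) / (xs - x 0 i)) := by
    intro t ht
    rw [← abs_of_pos (hwp t ht), abs_div, abs_sub_comm xs, abs_sub_comm xs]
    have : |x 0 i - xs| ≠ 0 := by rw [abs_sub_comm]; exact abs_ne_zero.2 h00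
    field_simp
  have hA : 0 < |x 0 i - xs| := abs_pos.2 (sub_ne_zero.2 hne)
  have hder : ∀ t ≥ (0:ℝ), -F (x t) t i / (xs - x 0 i) =
      -(F (x t) t i / (xs - x t i)) * ((xs - x t i) / (xs - x 0 i)) := by
    intro t ht
    have := hnz t ht
    field_simp
  have hev : (fun t => |x 0 i - xs| *
      Real.exp (-∫ s in (0:ℝ)..t, F (x s) s i / (xs - x s i))) =ᶠ[atTop]
      (fun t => |x t i - xs|) := by
    filter_upwards [eventually_ge_atTop 0] with t ht
    rw [habs t ht, hmain t ht]
  refine ⟨hmain, fun hg0 => ⟨?_, ?_, ?_⟩, fun hg0 => ?_⟩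
  · have hgp := pos_of_ne_zero_aux _ hgc hgn hg0
    have hanti : StrictAntiOn (fun t => (xs - x t i) / (xs - x 0 i)) (Set.Ici (0:ℝ)) := by
      refine strictAntiOn_of_deriv_neg (convex_Ici 0) hwc fun t ht => ?_
      have ht0 : 0 ≤ t := interior_subset ht
      rw [(hwd t ht0).deriv, hder t ht0]
      exact mul_neg_of_neg_of_pos (neg_neg_of_pos (hgp t ht0)) (hwp t ht0)
    intro a ha b hb hab
    simp only
    rw [habs a ha, habs b hb]
    exact mul_lt_mul_of_pos_left (hanti ha hb hab) hA
  · intro I hI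
    exact (((Real.continuous_exp.tendsto _).comp hI.neg).const_mul _).congr' hev
  · intro hI
    have h := (Real.tendsto_exp_neg_atTop_nhds_zero.comp hI).const_mul |x 0 i - xs|
    rw [mul_zero] at h
    exact h.congr' hev
  · have hgp := pos_of_ne_zero_aux _ hgc.neg (fun t ht => neg_ne_zero.2 (hgn t ht))
      (neg_pos.2 hg0)
    have hmono : StrictMonoOn (fun t => (xs - x t i) / (xs - x 0 i)) (Set.Ici (0:ℝ)) := by
      refine strictMonoOn_of_deriv_pos (convex_Ici 0) hwc fun t ht => ?_
      have ht0 : 0 ≤ t := interior_subset ht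
      rw [(hwd t ht0).deriv, hder t ht0]
      exact mul_pos (hgp t ht0) (hwp t ht0)
    intro a ha b hb hab
    simp only
    rw [habs a ha, habs b hb]
    exact mul_lt_mul_of_pos_left (hmono ha hb hab) hA
end

section
/- Consider a dynamical system ẋ = F(x,t) with F : ℝⁿ_{≥0} × ℝ_{≥0} → ℝⁿ continuously differentiable and forward-invariant nonnegative orthant, and suppose there exists x_i* > 0 such that for all x in the open positive orthant, F_i(x,t) = 0 if and only if x_i = x_i*. Let (x(t))_{t≥0} be a solution remaining in the positive orthant with x_i(0) ≠ x_i*. Then x_i(t) → x_i* as t → ∞ if and only if ∫₀^∞ F_i(x(t),t)/(x_i* − x_i(t)) dt = ∞. -/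
open Filter MeasureTheory Topology

/-- Theorem "zero load", part 4: along a positive solution with
`x_i(0) ≠ x_i*`, one has `x_i(t) → x_i*` as `t → ∞` if and only if
`∫₀^∞ F_i(x(t),t)/(x_i* − x_i(t)) dt = ∞`. -/
theorem stmt3 (n : ℕ) (F : (Fin n → ℝ) → ℝ → (Fin n → ℝ))
    (hF : ContDiffOn ℝ 1 (fun p : (Fin n → ℝ) × ℝ => F p.1 p.2)
      {p : (Fin n → ℝ) × ℝ | (∀ j, 0 ≤ p.1 j) ∧ 0 ≤ p.2})
    (hinv : ∀ y : ℝ → (Fin n → ℝ), (∀ t ≥ (0:ℝ), HasDerivAt y (F (y t) t) t) →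
      (∀ j, 0 ≤ y 0 j) → ∀ t ≥ (0:ℝ), ∀ j, 0 ≤ y t j)
    (i : Fin n) (xs : ℝ) (hxs : 0 < xs)
    (hzero : ∀ z : Fin n → ℝ, (∀ j, 0 < z j) → ∀ t ≥ (0:ℝ), (F z t i = 0 ↔ z i = xs))
    (x : ℝ → (Fin n → ℝ))
    (hsol : ∀ t ≥ (0:ℝ), HasDerivAt x (F (x t) t) t)
    (hpos : ∀ t ≥ (0:ℝ), ∀ j, 0 < x t j)
    (hne : x 0 i ≠ xs) :
    Tendsto (fun t => x t i) atTop (𝓝 xs) ↔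
      Tendsto (fun T => ∫ t in (0:ℝ)..T, F (x t) t i / (xs - x t i)) atTop atTop := by
  have hxi : ∀ t ≥ (0:ℝ), HasDerivAt (fun t => x t i) (F (x t) t i) t := fun t ht =>
    hasDerivAt_pi.1 (hsol t ht) i
  have hxc : ContinuousOn x (Set.Ici 0) := fun t ht => (hsol t ht).continuousAt.continuousWithinAt
  -- the coordinate never reaches its equilibrium value
  have key : ∀ T ≥ (0:ℝ), x T i ≠ xs := by
    intro T hT hEq
    obtain ⟨M, hM⟩ := (isCompact_Icc (a := (0:ℝ)) (b := T)).exists_bound_of_continuousOn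
      (hxc.mono Set.Icc_subset_Ici_self)
    set N : ℝ := max M xs with hN
    have hbox : ∀ t ∈ Set.Icc (0:ℝ) T, ∀ j, x t j ≤ N := fun t ht j =>
      (le_abs_self _).trans ((norm_le_pi_norm (x t) j).trans ((hM t ht).trans (le_max_left _ _)))
    have hcd : ContDiffOn ℝ 1 (fun p : (Fin n → ℝ) × ℝ => F p.1 p.2)
        (Set.Icc (0 : Fin n → ℝ) (fun _ => N) ×ˢ Set.Icc (0:ℝ) T) :=
      hF.mono fun p hp => ⟨fun j => hp.1.1 j, hp.2.1⟩
    obtain ⟨K, hK⟩ := hcd.exists_lipschitzOnWith one_ne_zero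
      ((convex_Icc _ _).prod (convex_Icc _ _)) (isCompact_Icc.prod isCompact_Icc)
    have hmem : ∀ t ∈ Set.Icc (0:ℝ) T, ∀ a ∈ Set.Icc (0:ℝ) N,
        (Function.update (x t) i a, t) ∈
          (Set.Icc (0 : Fin n → ℝ) (fun _ => N) ×ˢ Set.Icc (0:ℝ) T) := by
      intro t ht a ha
      refine ⟨⟨fun j => ?_, fun j => ?_⟩, ht⟩
      · by_cases hj : j = i
        · subst hj; simpa using ha.1
        · simpa [hj] using (hpos t ht.1 j).le
      · by_cases hj : j = i
        · subst hj; simpa using ha.2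
        · simpa [hj] using hbox t ht j
    have hlip : ∀ t ∈ Set.Ioc (0:ℝ) T,
        LipschitzOnWith K (fun a => F (Function.update (x t) i a) t i) (Set.Icc (0:ℝ) N) := by
      intro t ht
      have ht' : t ∈ Set.Icc (0:ℝ) T := ⟨ht.1.le, ht.2⟩
      refine LipschitzOnWith.of_dist_le_mul fun a ha b hb => ?_
      have h1 := hK.dist_le_mul _ (hmem t ht' a ha) _ (hmem t ht' b hb)
      refine (dist_le_pi_dist (F (Function.update (x t) i a) t)
        (F (Function.update (x t) i b) t) i).trans (h1.trans ?_)
      refine mul_le_mul_of_nonneg_left ?_ K.2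
      rw [Prod.dist_eq]
      refine max_le ?_ (by simp)
      refine (dist_pi_le_iff dist_nonneg).2 fun j => ?_
      by_cases hj : j = i
      · subst hj; simp
      · simp [hj]
    have huniq := ODE_solution_unique_of_mem_Icc_left
      (v := fun t a => F (Function.update (x t) i a) t i) (s := fun _ => Set.Icc (0:ℝ) N)
      (K := K) (f := fun t => x t i) (g := fun _ => xs) (a := 0) (b := T) hlip
      (fun t ht => (hxi t ht.1).continuousAt.continuousWithinAt)
      (fun t ht => by simpa using (hxi t ht.1.le).hasDerivWithinAt)
      (fun t ht => ⟨(hpos t ht.1.le i).le, hbox t ⟨ht.1.le, ht.2⟩ i⟩)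
      continuousOn_const
      (fun t ht => by
        have h0 : F (Function.update (x t) i xs) t i = 0 := by
          refine (hzero _ (fun j => ?_) t ht.1.le).2 (by simp)
          by_cases hj : j = i
          · subst hj; simpa using hxs
          · simpa [hj] using hpos t ht.1.le j
        simp only [h0]
        exact hasDerivWithinAt_const _ _ _)
      (fun t ht => ⟨hxs.le, le_max_right _ _⟩) hEq
    exact hne (huniq ⟨le_rfl, hT⟩)
  have hsub : ∀ t ≥ (0:ℝ), xs - x t i ≠ 0 := fun t ht => sub_ne_zero.2 (key t ht).symm
  have hFc : ContinuousOn (fun t => F (x t) t i) (Set.Ici 0) := by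
    have h1 : ContinuousOn (fun t => F (x t) t) (Set.Ici 0) :=
      hF.continuousOn.comp (hxc.prodMk continuousOn_id)
        (fun t ht => ⟨fun j => (hpos t ht j).le, ht⟩)
    exact (continuous_apply i).comp_continuousOn h1
  have hint : ∀ T ≥ (0:ℝ), ∫ t in (0:ℝ)..T, F (x t) t i / (xs - x t i) =
      Real.log (xs - x 0 i) - Real.log (xs - x T i) := by
    intro T hT
    have h := intervalIntegral.integral_eq_sub_of_hasDerivAt
      (f := fun t => - Real.log (xs - x t i)) (f' := fun t => F (x t) t i / (xs - x t i))
      (a := 0) (b := T) ?_ ?_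
    · rw [h]; ring
    · intro t ht
      rw [Set.uIcc_of_le hT] at ht
      convert (((hxi t ht.1).const_sub xs).log (hsub t ht.1)).neg using 1
      · rfl
      · ring
    · apply ContinuousOn.intervalIntegrable
      rw [Set.uIcc_of_le hT]
      have hs : Set.Icc (0:ℝ) T ⊆ Set.Ici 0 := Set.Icc_subset_Ici_self
      exact (hFc.mono hs).div
        (fun t ht => ((hxi t ht.1).const_sub xs).continuousAt.continuousWithinAt)
        (fun t ht => hsub t ht.1)
  have hev : (fun T => ∫ t in (0:ℝ)..T, F (x t) t i / (xs - x t i)) =ᶠ[atTop]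
      fun T => Real.log (xs - x 0 i) + - Real.log (xs - x T i) := by
    filter_upwards [eventually_ge_atTop (0:ℝ)] with T hT
    rw [hint T hT]; ring
  rw [tendsto_congr' hev]
  constructor
  · intro h
    have h1 : Tendsto (fun t => xs - x t i) atTop (𝓝[≠] 0) := by
      refine tendsto_nhdsWithin_iff.2 ⟨by simpa using h.const_sub xs, ?_⟩
      filter_upwards [eventually_ge_atTop (0:ℝ)] with T hT using hsub T hT
    exact tendsto_atTop_add_const_left _ _
      (tendsto_neg_atBot_atTop.comp (Real.tendsto_log_nhdsNE_zero.comp h1))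
  · intro h
    have h1 : Tendsto (fun t => Real.log (xs - x t i)) atTop atBot := by
      have h2 := tendsto_neg_atTop_atBot.comp
        (tendsto_atTop_add_const_left _ (-Real.log (xs - x 0 i)) h)
      refine h2.congr fun t => ?_
      simp
    have h2 := Real.tendsto_exp_atBot.comp h1
    have h3 : Tendsto (fun t => |xs - x t i|) atTop (𝓝 0) := by
      refine h2.congr' ?_
      filter_upwards [eventually_ge_atTop (0:ℝ)] with T hT
      exact Real.exp_log_eq_abs (hsub T hT)
    have h4 := (tendsto_zero_iff_abs_tendsto_zero _).2 h3
    simpa using h4.const_sub xs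
end

section
/- Consider a dynamical system ẋ = F(x,t) with F : ℝⁿ_{≥0} × ℝ_{≥0} → ℝⁿ continuously differentiable and forward-invariant nonnegative orthant, and suppose there exists x_i* > 0 such that for all x in the open positive orthant, F_i(x,t) = 0 if and only if x_i = x_i*. Let (x(t))_{t≥0} be a solution remaining in the positive orthant with x_i(0) ≠ x_i*. If liminf_{t→∞} t·F_i(x(t),t)/(x_i* − x_i(t)) > 0 (allowing the value +∞), then x_i(t) → x_i* as t → ∞. -/
open Filter MeasureTheory Topology

/-- Corollary to the zero-load theorem: if
`liminf_{t→∞} t·F_i(x(t),t)/(x_i* − x_i(t)) ∈ (0,∞]` (computed in the extended reals),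
then `x_i(t) → x_i*` as `t → ∞`. -/
theorem stmt4 (n : ℕ) (F : (Fin n → ℝ) → ℝ → (Fin n → ℝ))
    (hF : ContDiffOn ℝ 1 (fun p : (Fin n → ℝ) × ℝ => F p.1 p.2)
      {p : (Fin n → ℝ) × ℝ | (∀ j, 0 ≤ p.1 j) ∧ 0 ≤ p.2})
    (hinv : ∀ y : ℝ → (Fin n → ℝ), (∀ t ≥ (0:ℝ), HasDerivAt y (F (y t) t) t) →
      (∀ j, 0 ≤ y 0 j) → ∀ t ≥ (0:ℝ), ∀ j, 0 ≤ y t j)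
    (i : Fin n) (xs : ℝ) (hxs : 0 < xs)
    (hzero : ∀ z : Fin n → ℝ, (∀ j, 0 < z j) → ∀ t ≥ (0:ℝ), (F z t i = 0 ↔ z i = xs))
    (x : ℝ → (Fin n → ℝ))
    (hsol : ∀ t ≥ (0:ℝ), HasDerivAt x (F (x t) t) t)
    (hpos : ∀ t ≥ (0:ℝ), ∀ j, 0 < x t j)
    (hne : x 0 i ≠ xs)
    (hliminf : (0 : EReal) <
      Filter.liminf (fun t : ℝ =>
        ((t * (F (x t) t i / (xs - x t i)) : ℝ) : EReal)) atTop) :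
    Tendsto (fun t => x t i) atTop (𝓝 xs) := by
  obtain ⟨c, hc0, hc⟩ := EReal.lt_iff_exists_real_btwn.1 hliminf
  have hc0' : 0 < c := by exact_mod_cast hc0
  have hev := eventually_lt_of_lt_liminf hc
  obtain ⟨T, hT⟩ := eventually_atTop.1 (hev.and (eventually_gt_atTop (0:ℝ)))
  have hTpos : 0 < T := (hT T le_rfl).2
  have hder : ∀ t, T ≤ t → HasDerivAt (fun s : ℝ => s ^ (2 * c) * (x s i - xs) ^ 2)
      ((2 * c) * t ^ (2 * c - 1) * (x t i - xs) ^ 2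
        + t ^ (2 * c) * (2 * (x t i - xs) * F (x t) t i)) t := by
    intro t ht
    have htpos : 0 < t := lt_of_lt_of_le hTpos ht
    have h1 : HasDerivAt (fun s => x s i) (F (x t) t i) t :=
      (hasDerivAt_pi.1 (hsol t htpos.le)) i
    have h2 := (h1.sub_const xs).pow 2
    have h3 := Real.hasDerivAt_rpow_const (x := t) (p := 2 * c) (Or.inl htpos.ne')
    have h4 := h3.mul h2
    refine HasDerivAt.congr_deriv h4 ?_
    simp
  have hanti : AntitoneOn (fun s : ℝ => s ^ (2 * c) * (x s i - xs) ^ 2) (Set.Ici T) := by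
    apply antitoneOn_of_deriv_nonpos (convex_Ici T)
    · intro t ht
      exact (hder t ht).continuousAt.continuousWithinAt
    · intro t ht
      rw [interior_Ici] at ht
      exact (hder t (le_of_lt ht)).differentiableAt.differentiableWithinAt
    · intro t ht
      rw [interior_Ici] at ht
      have ht' : T ≤ t := le_of_lt ht
      have htpos : 0 < t := lt_of_lt_of_le hTpos ht'
      rw [(hder t ht').deriv]
      have hlt : c < t * (F (x t) t i / (xs - x t i)) := by exact_mod_cast (hT t ht').1
      have hne' : xs - x t i ≠ 0 := by
        intro h
        rw [h] at hlt
        simp at hlt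
        linarith
      set q := F (x t) t i / (xs - x t i) with hq
      have hFq : F (x t) t i = q * (xs - x t i) := by
        rw [hq]; field_simp
      have hpw : t ^ (2 * c) = t ^ (2 * c - 1) * t := by
        rw [← Real.rpow_add_one htpos.ne']; congr 1; ring
      rw [hFq, hpw]
      have hp : 0 ≤ t ^ (2 * c - 1) * (x t i - xs) ^ 2 := by positivity
      nlinarith [mul_nonneg hp (sub_nonneg.2 hlt.le)]
  have hlim : Tendsto (fun t : ℝ => T ^ (2 * c) * (x T i - xs) ^ 2 * t ^ (-(2 * c)))
      atTop (𝓝 0) := by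
    simpa using (tendsto_rpow_neg_atTop (y := 2 * c) (by positivity)).const_mul
      (T ^ (2 * c) * (x T i - xs) ^ 2)
  have hsq : Tendsto (fun t => (x t i - xs) ^ 2) atTop (𝓝 0) := by
    refine squeeze_zero' (Eventually.of_forall fun t => sq_nonneg _) ?_ hlim
    filter_upwards [eventually_ge_atTop T] with t ht
    have htpos : 0 < t := lt_of_lt_of_le hTpos ht
    have h := hanti (Set.mem_Ici.2 le_rfl) (Set.mem_Ici.2 ht) ht
    simp only at h
    rw [Real.rpow_neg htpos.le, ← div_eq_mul_inv, le_div_iff₀ (by positivity)]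
    linarith
  have habs : Tendsto (fun t => |x t i - xs|) atTop (𝓝 0) := by
    have := hsq.sqrt
    simpa [Real.sqrt_sq_eq_abs] using this
  rw [tendsto_iff_dist_tendsto_zero]
  simpa [Real.dist_eq] using habs
end

section
/- (Power-engine-load convergence theorem.) Consider a dynamical system ẋ = F(x,t) with F : ℝⁿ_{≥0} × ℝ_{≥0} → ℝⁿ and forward-invariant nonnegative orthant. Suppose for some coordinate i, F_i(x,t) = f(x,t)·(x_i* − x_i) + g(x,t) with f(x,t) > 0 on the open positive orthant for t > 0. Let (x(t))_{t≥0} be a solution remaining in the positive orthant such that ∫₀^∞ f(x(t),t) dt = ∞ and such that the limit α := lim_{t→∞} g(x(t),t)/f(x(t),t) exists with α > −x_i*. Then x_i(t) → x_i* + α as t → ∞. -/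
open Filter MeasureTheory Topology

theorem pel_aux (u D p : ℝ → ℝ) (T0 c ε : ℝ) (hε : 0 < ε)
    (hp : ∀ t, T0 ≤ t → 0 < p t)
    (hu : ∀ t, T0 ≤ t → HasDerivAt u (D t) t)
    (hD : ∀ t, T0 ≤ t → c ≤ u t → D t ≤ -ε * p t)
    (hpi : ∀ T, T0 ≤ T → IntervalIntegrable p volume T0 T)
    (hint : Tendsto (fun T => ∫ t in T0..T, p t) atTop atTop) :
    ∀ᶠ t in atTop, u t ≤ c := by
  have hex : ∃ t1, T0 ≤ t1 ∧ u t1 ≤ c := by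
    by_contra! hcon
    obtain ⟨T, hT, hT0⟩ := ((hint.eventually_gt_atTop ((u T0 - c) / ε)).and
      (eventually_ge_atTop T0)).exists
    have h1 : u T - u T0 ≤ ∫ t in T0..T, -ε * p t := by
      refine intervalIntegral.sub_le_integral_of_hasDeriv_right_of_le hT0
        (fun t ht => (hu t ht.1).continuousAt.continuousWithinAt)
        (fun t ht => (hu t ht.1.le).hasDerivWithinAt) ?_
        (fun t ht => hD t ht.1.le (hcon t ht.1.le).le)
      have := (hpi T hT0).const_mul (-ε)
      rwa [intervalIntegrable_iff_integrableOn_Icc_of_le hT0] at this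
    rw [intervalIntegral.integral_const_mul] at h1
    have h2 := hcon T hT0
    rw [div_lt_iff₀ hε] at hT
    linarith
  obtain ⟨t1, ht1, hc⟩ := hex
  filter_upwards [eventually_ge_atTop t1] with t ht
  refine image_le_of_deriv_right_lt_deriv_boundary' (f := u) (f' := D) (a := t1) (b := t)
    (B := fun _ => c) (B' := fun _ => 0)
    (fun s hs => (hu s (ht1.trans hs.1)).continuousAt.continuousWithinAt)
    (fun s hs => (hu s (ht1.trans hs.1)).hasDerivWithinAt) hc
    continuousOn_const (fun s _ => hasDerivWithinAt_const _ _ _) ?_ ⟨ht, le_rfl⟩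
  intro s hs he
  have h1 := hD s (ht1.trans hs.1) he.ge
  have h2 := mul_pos hε (hp s (ht1.trans hs.1))
  linarith

/-- Power-engine-load convergence theorem: if coordinate `i` has the
power-engine-load form `F_i(x,t) = f(x,t)·(x_i* − x_i) + g(x,t)` with power `f > 0` on
the open positive orthant for `t > 0`, and along a positive solution
`∫₀^∞ f(x(t),t) dt = ∞` and `g(x(t),t)/f(x(t),t) → α` with `α > −x_i*`, then
`x_i(t) → x_i* + α`. -/
theorem stmt5 (n : ℕ) (F : (Fin n → ℝ) → ℝ → (Fin n → ℝ))
    (f g : (Fin n → ℝ) → ℝ → ℝ)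
    (hinv : ∀ y : ℝ → (Fin n → ℝ), (∀ t ≥ (0:ℝ), HasDerivAt y (F (y t) t) t) →
      (∀ j, 0 ≤ y 0 j) → ∀ t ≥ (0:ℝ), ∀ j, 0 ≤ y t j)
    (i : Fin n) (xs : ℝ) (hxs : 0 < xs)
    (hform : ∀ z : Fin n → ℝ, (∀ j, 0 ≤ z j) → ∀ t ≥ (0:ℝ),
      F z t i = f z t * (xs - z i) + g z t)
    (hf : ∀ z : Fin n → ℝ, (∀ j, 0 < z j) → ∀ t : ℝ, 0 < t → 0 < f z t)
    (x : ℝ → (Fin n → ℝ))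
    (hsol : ∀ t ≥ (0:ℝ), HasDerivAt x (F (x t) t) t)
    (hpos : ∀ t ≥ (0:ℝ), ∀ j, 0 < x t j)
    (hint : Tendsto (fun T => ∫ t in (0:ℝ)..T, f (x t) t) atTop atTop)
    (α : ℝ) (hα : Tendsto (fun t => g (x t) t / f (x t) t) atTop (𝓝 α))
    (hαgt : -xs < α) :
    Tendsto (fun t => x t i) atTop (𝓝 (xs + α)) := by
  have hI : ∀ T, 0 ≤ T → IntervalIntegrable (fun t => f (x t) t) volume 0 T := by
    intro T hT
    obtain ⟨S, hS, hTS⟩ := ((hint.eventually_gt_atTop 0).and (eventually_ge_atTop T)).exists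
    have hSi : IntervalIntegrable (fun t => f (x t) t) volume 0 S := by
      by_contra h
      rw [intervalIntegral.integral_undef h] at hS
      exact lt_irrefl _ hS
    refine hSi.mono_set ?_
    rw [Set.uIcc_of_le hT, Set.uIcc_of_le (hT.trans hTS)]
    exact Set.Icc_subset_Icc_right hTS
  have key : ∀ ε > 0, (∀ᶠ t in atTop, x t i ≤ xs + α + 2 * ε) ∧
      ∀ᶠ t in atTop, -x t i ≤ -(xs + α - 2 * ε) := by
    intro ε hε
    obtain ⟨T1, hT1⟩ := eventually_atTop.1 (Metric.tendsto_nhds.1 hα ε hε)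
    set T0 := max T1 1 with hT0
    have h0 : ∀ t, T0 ≤ t → 0 < t := fun t ht =>
      lt_of_lt_of_le one_pos ((le_max_right _ _).trans ht)
    have hp : ∀ t, T0 ≤ t → 0 < f (x t) t := fun t ht =>
      hf _ (hpos t (h0 t ht).le) t (h0 t ht)
    have hu : ∀ t, T0 ≤ t → HasDerivAt (fun t => x t i) (F (x t) t i) t := fun t ht =>
      hasDerivAt_pi.1 (hsol t (h0 t ht).le) i
    have hpi : ∀ T, T0 ≤ T → IntervalIntegrable (fun t => f (x t) t) volume T0 T :=
      fun T hT => (hI T0 (h0 _ le_rfl).le).symm.trans (hI T (h0 _ hT).le)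
    have hin : Tendsto (fun T => ∫ t in T0..T, f (x t) t) atTop atTop := by
      refine Tendsto.congr' ?_ (tendsto_atTop_add_const_right _
        (-∫ t in (0:ℝ)..T0, f (x t) t) hint)
      filter_upwards [eventually_ge_atTop T0] with T hT
      rw [← intervalIntegral.integral_add_adjacent_intervals (hI T0 (h0 _ le_rfl).le) (hpi T hT)]
      ring
    have hFe : ∀ t, T0 ≤ t → ∃ r, |r - α| < ε ∧ F (x t) t i = f (x t) t * (xs + r - x t i) := by
      intro t ht
      refine ⟨g (x t) t / f (x t) t, hT1 t ((le_max_left _ _).trans ht), ?_⟩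
      rw [hform _ (fun j => (hpos t (h0 t ht).le j).le) t (h0 t ht).le]
      have := (hp t ht).ne'
      field_simp
      ring
    constructor
    · refine pel_aux _ _ _ T0 _ ε hε hp hu ?_ hpi hin
      intro t ht hc
      obtain ⟨r, hr, he⟩ := hFe t ht
      rw [he]
      have := abs_lt.1 hr
      nlinarith [hp t ht]
    · refine pel_aux _ _ _ T0 _ ε hε hp (fun t ht => (hu t ht).neg) ?_ hpi hin
      intro t ht hc
      obtain ⟨r, hr, he⟩ := hFe t ht
      rw [he]
      have := abs_lt.1 hr
      nlinarith [hp t ht]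
  rw [Metric.tendsto_nhds]
  intro ε hε
  obtain ⟨h1, h2⟩ := key (ε / 4) (by positivity)
  filter_upwards [h1, h2] with t h1 h2
  rw [Real.dist_eq, abs_lt]
  constructor <;> linarith
end

section
/- (Positive slope motif with inflows.) Let k₁, k₂ > 0 and k* = k₂/k₁. Let a, b : [0,∞) → ℝ_{>0} be differentiable and satisfy ȧ(t) = k₁·b(t)·(k* − a(t)) + g_a(t) and ḃ(t) = k₁·b(t)·(k* − a(t)) + g_b(t), where g_a, g_b : ℝ_{≥0} → ℝ_{≥0} are such that g_a is bounded and ∫₀^∞ (g_b(t) − g_a(t)) dt = ∞ (i.e., ∫₀^T (g_b − g_a) dt → ∞ as T → ∞). Then a(t) → k* as t → ∞. -/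
open Filter MeasureTheory Topology

/-- A function decreasing at speed at least one above level `c` is eventually at most `c`. -/
lemma eventually_le_of_deriv (f f' : ℝ → ℝ) (T c : ℝ)
    (hf : ∀ t ≥ T, HasDerivAt f (f' t) t)
    (hd : ∀ t ≥ T, c ≤ f t → f' t ≤ -1) : ∀ᶠ t in atTop, f t ≤ c := by
  have hex : ∃ s ≥ T, f s ≤ c := by
    by_contra! hcon
    set U := T + 2 * (f T - c) with hU
    have hTc := hcon T le_rfl
    have hTU : T ≤ U := by linarith
    have key := image_le_of_deriv_right_lt_deriv_boundary (f := f) (f' := f') (a := T) (b := U)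
      (fun x hx => (hf x hx.1).continuousAt.continuousWithinAt)
      (fun x hx => (hf x hx.1).hasDerivWithinAt)
      (B := fun t => f T - (1/2) * (t - T)) (B' := fun _ => -(1/2)) (by simp)
      (fun x => by
        have := (((hasDerivAt_id x).sub_const T).const_mul (1/2 : ℝ)).const_sub (f T)
        simpa using this)
      (fun x hx _ => by
        have := hd x hx.1 (hcon x hx.1).le
        linarith)
      (x := U) ⟨hTU, le_rfl⟩
    have := hcon U hTU
    linarith
  obtain ⟨s, hs, hsc⟩ := hex
  filter_upwards [eventually_ge_atTop s] with t ht
  exact image_le_of_deriv_right_lt_deriv_boundary (f := f) (f' := f') (a := s) (b := t)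
      (fun x hx => (hf x (hs.le.trans hx.1)).continuousAt.continuousWithinAt)
      (fun x hx => (hf x (hs.le.trans hx.1)).hasDerivWithinAt)
      (B := fun _ => c) (B' := fun _ => 0) hsc
      (fun x => hasDerivAt_const x c)
      (fun x hx h => by
        have := hd x (hs.le.trans hx.1) (le_of_eq h.symm)
        linarith)
      (x := t) ⟨ht, le_rfl⟩

/-- Positive slope motif with inflows: for the mass action system
`ȧ = k₁b(k* − a) + g_a(t)`, `ḃ = k₁b(k* − a) + g_b(t)` with `k* = k₂/k₁`, nonnegative
inflow rates, `g_a` bounded and `∫₀^∞ (g_b − g_a) dt = ∞`, one has `a(t) → k*`. -/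
theorem stmt6 (k₁ k₂ ks : ℝ) (hk₁ : 0 < k₁) (hk₂ : 0 < k₂) (hks : ks = k₂ / k₁)
    (ga gb : ℝ → ℝ)
    (hga0 : ∀ t ≥ (0:ℝ), 0 ≤ ga t) (hgb0 : ∀ t ≥ (0:ℝ), 0 ≤ gb t)
    (hbound : ∃ M : ℝ, ∀ t ≥ (0:ℝ), ga t ≤ M)
    (hint : Tendsto (fun T => ∫ t in (0:ℝ)..T, (gb t - ga t)) atTop atTop)
    (a b : ℝ → ℝ)
    (hapos : ∀ t ≥ (0:ℝ), 0 < a t) (hbpos : ∀ t ≥ (0:ℝ), 0 < b t)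
    (ha : ∀ t ≥ (0:ℝ), HasDerivAt a (k₁ * b t * (ks - a t) + ga t) t)
    (hb : ∀ t ≥ (0:ℝ), HasDerivAt b (k₁ * b t * (ks - a t) + gb t) t) :
    Tendsto a atTop (𝓝 ks) := by
  obtain ⟨M, hM⟩ := hbound
  have hM0 : 0 ≤ M := (hga0 0 le_rfl).trans (hM 0 le_rfl)
  have hbtop : Tendsto b atTop atTop := by
    have h1 : Tendsto (fun T => (∫ t in (0:ℝ)..T, (gb t - ga t)) + (b 0 - a 0)) atTop atTop :=
      tendsto_atTop_add_const_right _ _ hint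
    refine tendsto_atTop_mono' _ ?_ h1
    filter_upwards [hint.eventually_gt_atTop 0, eventually_ge_atTop (0:ℝ)] with T hT hT0
    have hii : IntervalIntegrable (fun t => gb t - ga t) volume 0 T := by
      by_contra hni
      rw [intervalIntegral.integral_undef hni] at hT
      exact lt_irrefl _ hT
    have hftc := intervalIntegral.integral_eq_sub_of_hasDerivAt (a := 0) (b := T)
      (f := fun t => b t - a t) (f' := fun t => gb t - ga t)
      (fun x hx => by
        rw [Set.uIcc_of_le hT0] at hx
        have := (hb x hx.1).sub (ha x hx.1)
        have he : k₁ * b x * (ks - a x) + gb x - (k₁ * b x * (ks - a x) + ga x)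
            = gb x - ga x := by ring
        rw [he] at this
        exact this) hii
    have := hapos T hT0
    simp only [hftc]
    linarith
  have main : ∀ ε > 0, ∀ᶠ t in atTop, a t ≤ ks + ε ∧ ks - ε ≤ a t := by
    intro ε hε
    obtain ⟨T, hT⟩ := eventually_atTop.1 (hbtop.eventually_ge_atTop ((M + 1) / (k₁ * ε)))
    have hN : ∀ t ≥ max T 0, M + 1 ≤ k₁ * b t * ε := by
      intro t ht
      have := hT t ((le_max_left _ _).trans ht)
      rw [div_le_iff₀ (by positivity)] at this
      linarith
    have h0 : ∀ t ≥ max T 0, 0 ≤ t := fun t ht => (le_max_right _ _).trans ht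
    have hp : ∀ t ≥ max T 0, 0 < k₁ * b t := fun t ht => mul_pos hk₁ (hbpos t (h0 t ht))
    have hup := eventually_le_of_deriv a _ (max T 0) (ks + ε) (fun t ht => ha t (h0 t ht))
      (fun t ht hc => by
        have h1 := hN t ht
        have h2 := hM t (h0 t ht)
        have h3 := mul_le_mul_of_nonneg_left (show ks - a t ≤ -ε by linarith) (hp t ht).le
        linarith)
    have hlo := eventually_le_of_deriv (fun t => -a t) _ (max T 0) (-(ks - ε))
      (fun t ht => (ha t (h0 t ht)).neg)
      (fun t ht hc => by
        have h1 := hN t ht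
        have h2 := hga0 t (h0 t ht)
        have h3 := mul_le_mul_of_nonneg_left (show ε ≤ ks - a t by linarith) (hp t ht).le
        linarith)
    filter_upwards [hup, hlo] with t h1 h2
    exact ⟨h1, by linarith⟩
  rw [Metric.tendsto_nhds]
  intro ε hε
  filter_upwards [main (ε / 2) (by linarith)] with t ht
  rw [Real.dist_eq, abs_lt]
  constructor <;> linarith [ht.1, ht.2]
end

section
/- (Positive slope motif with constant inflows.) Let k₁, k₂ > 0 and k* = k₂/k₁, and let g_a, g_b ≥ 0 be constants with g_b > g_a. Let a, b : [0,∞) → ℝ_{>0} be differentiable and satisfy ȧ(t) = k₁·b(t)·(k* − a(t)) + g_a and ḃ(t) = k₁·b(t)·(k* − a(t)) + g_b. Then a(t) → k* as t → ∞. -/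
open Filter MeasureTheory Topology

/-- Positive slope motif with constant inflows: for the mass action
system `ȧ = k₁b(k* − a) + g_a`, `ḃ = k₁b(k* − a) + g_b` with constant inflows
`g_b > g_a ≥ 0` and `k* = k₂/k₁`, one has `a(t) → k*`. -/
theorem stmt7 (k₁ k₂ ks : ℝ) (hk₁ : 0 < k₁) (hk₂ : 0 < k₂) (hks : ks = k₂ / k₁)
    (ga gb : ℝ) (hga0 : 0 ≤ ga) (hgb0 : 0 ≤ gb) (hgab : ga < gb)
    (a b : ℝ → ℝ)
    (hapos : ∀ t ≥ (0:ℝ), 0 < a t) (hbpos : ∀ t ≥ (0:ℝ), 0 < b t)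
    (ha : ∀ t ≥ (0:ℝ), HasDerivAt a (k₁ * b t * (ks - a t) + ga) t)
    (hb : ∀ t ≥ (0:ℝ), HasDerivAt b (k₁ * b t * (ks - a t) + gb) t) :
    Tendsto a atTop (𝓝 ks) := by
  -- b - a is affine
  have hdiff : ∀ t ≥ (0:ℝ), b 0 - a 0 + (gb - ga) * t ≤ b t - a t := by
    have hmono : MonotoneOn (fun t => b t - a t - (gb - ga) * t) (Set.Ici 0) := by
      have hd : ∀ t ≥ (0:ℝ), HasDerivAt (fun t => b t - a t - (gb - ga) * t) 0 t := by
        intro t ht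
        have h := ((hb t ht).sub (ha t ht)).sub ((hasDerivAt_id t).const_mul (gb - ga))
        refine HasDerivAt.congr_deriv h ?_
        ring
      apply monotoneOn_of_deriv_nonneg (convex_Ici 0)
      · intro t ht
        exact (hd t ht).continuousAt.continuousWithinAt
      · intro t ht
        exact (hd t (interior_subset ht)).differentiableAt.differentiableWithinAt
      · intro t ht
        rw [(hd t (interior_subset ht)).deriv]
    intro t ht
    have h := hmono (Set.mem_Ici.2 le_rfl) (Set.mem_Ici.2 ht) ht
    simp only [mul_zero, sub_zero] at h
    linarith
  -- b tends to infinity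
  have hbig : Tendsto b atTop atTop := by
    have h1 : Tendsto (fun t : ℝ => b 0 - a 0 + (gb - ga) * t) atTop atTop :=
      tendsto_atTop_add_const_left _ _ (tendsto_id.const_mul_atTop (sub_pos.2 hgab))
    refine tendsto_atTop_mono' _ ?_ h1
    filter_upwards [eventually_ge_atTop 0] with t ht
    have := hdiff t ht
    have := hapos t ht
    linarith
  -- squared distance becomes small
  have key : ∀ η > (0:ℝ), ∀ᶠ t in atTop, (a t - ks) ^ 2 < η := by
    intro η hη
    obtain ⟨p, hp, hpη⟩ : ∃ p : ℝ, 0 < p ∧ p < η := ⟨η / 2, by linarith, by linarith⟩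
    obtain ⟨N, hN, hNp⟩ : ∃ N : ℝ, 0 < N ∧ ga ^ 2 ≤ N * p := by
      refine ⟨(ga ^ 2 + 1) / p, by positivity, ?_⟩
      rw [div_mul_cancel₀ _ hp.ne']
      linarith
    obtain ⟨T, hT⟩ := eventually_atTop.1
      ((hbig.eventually_ge_atTop ((N + 1) / (2 * k₁))).and (eventually_ge_atTop (0:ℝ)))
    have hT0 : ∀ t ≥ T, 0 ≤ t := fun t ht => (hT t ht).2
    have hTN : ∀ t ≥ T, N + 1 ≤ 2 * k₁ * b t := by
      intro t ht
      have h := (hT t ht).1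
      rw [div_le_iff₀ (by positivity)] at h
      linarith
    have hd : ∀ t ≥ T, HasDerivAt (fun t => Real.exp (N * t) * ((a t - ks) ^ 2 - p))
        (Real.exp (N * t) * (N * ((a t - ks) ^ 2 - p)
          + 2 * (a t - ks) * (k₁ * b t * (ks - a t) + ga))) t := by
      intro t ht
      have h1 := ((hasDerivAt_id t).const_mul N).exp
      have h2 := (((ha t (hT0 t ht)).sub_const ks).pow 2).sub_const p
      refine HasDerivAt.congr_deriv (h1.mul h2) ?_
      simp
      ring
    have hanti : AntitoneOn (fun t => Real.exp (N * t) * ((a t - ks) ^ 2 - p)) (Set.Ici T) := by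
      apply antitoneOn_of_deriv_nonpos (convex_Ici T)
      · intro t ht
        exact (hd t ht).continuousAt.continuousWithinAt
      · intro t ht
        exact (hd t (interior_subset ht)).differentiableAt.differentiableWithinAt
      · intro t ht
        have ht' : t ≥ T := interior_subset ht
        rw [(hd t ht').deriv]
        apply mul_nonpos_of_nonneg_of_nonpos (Real.exp_pos _).le
        have h1 := mul_le_mul_of_nonneg_right (hTN t ht') (sq_nonneg (a t - ks))
        nlinarith [sq_nonneg (a t - ks - ga)]
    set C := Real.exp (N * T) * ((a T - ks) ^ 2 - p) with hC
    have hlim : Tendsto (fun t : ℝ => p + C * Real.exp (-(N * t))) atTop (𝓝 (p + C * 0)) :=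
      ((Real.tendsto_exp_neg_atTop_nhds_zero.comp
        (tendsto_id.const_mul_atTop hN)).const_mul C).const_add p
    rw [mul_zero, add_zero] at hlim
    filter_upwards [hlim.eventually_lt_const hpη, eventually_ge_atTop T] with t h1 h2
    have h3 : Real.exp (N * t) * ((a t - ks) ^ 2 - p) ≤ C :=
      hanti (Set.mem_Ici.2 le_rfl) (Set.mem_Ici.2 h2) h2
    have h4 := mul_le_mul_of_nonneg_right h3 (Real.exp_pos (-(N * t))).le
    have h5 : Real.exp (N * t) * Real.exp (-(N * t)) = 1 := by
      rw [← Real.exp_add]; simp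
    have h6 : Real.exp (N * t) * ((a t - ks) ^ 2 - p) * Real.exp (-(N * t))
        = (a t - ks) ^ 2 - p := by
      linear_combination ((a t - ks) ^ 2 - p) * h5
    linarith
  rw [Metric.tendsto_nhds]
  intro ε hε
  filter_upwards [key (ε ^ 2) (by positivity)] with t ht
  rw [Real.dist_eq]
  exact abs_lt_of_sq_lt_sq ht hε.le
end

section
/- (Negative slope motif with time-dependent inflows.) Let k₁, k₂ > 0 and k* = k₂/k₁. Let g_a, g_b : ℝ_{≥0} → ℝ_{≥0} and set G(t) = ∫₀ᵗ (g_a(s) + g_b(s)) ds. Assume G(t) → ∞ as t → ∞ and that g_a(t)/G(t) → α as t → ∞ for some α ≥ 0. Let a, b : [0,∞) → ℝ_{>0} be differentiable with (a(0), b(0)) in the open positive quadrant, satisfying ȧ(t) = k₁·b(t)·(k* − a(t)) + g_a(t) and ḃ(t) = −k₁·b(t)·(k* − a(t)) + g_b(t). Then a(t) → k* + α/k₁ as t → ∞. -/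
open Filter MeasureTheory Topology

lemma aux_trap (f f' : ℝ → ℝ) (T c : ℝ) (hf : ∀ t ≥ T, HasDerivAt f (f' t) t)
    (hb : ∀ t ≥ T, f t = c → f' t < 0) (h : ∃ t ≥ T, f t ≤ c) :
    ∀ᶠ t in atTop, f t ≤ c := by
  obtain ⟨t0, ht0, h0⟩ := h
  filter_upwards [eventually_ge_atTop t0] with t ht
  refine image_le_of_deriv_right_lt_deriv_boundary (f := f) (f' := f') (a := t0) (b := t)
    (B := fun _ => c) (B' := fun _ => 0) ?_ ?_ h0 (fun x => hasDerivAt_const x c) ?_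
    ⟨ht, le_refl t⟩
  · intro x hx
    exact (hf x (ht0.trans hx.1)).continuousAt.continuousWithinAt
  · intro x hx
    exact (hf x (ht0.trans hx.1)).hasDerivWithinAt
  · intro x hx hxc
    exact hb x (ht0.trans hx.1) hxc

lemma aux_grow (f f' : ℝ → ℝ) (T m : ℝ) (hm : 0 < m) (hf : ∀ t ≥ T, HasDerivAt f (f' t) t)
    (hb : ∀ t ≥ T, m ≤ f' t) : Tendsto f atTop atTop := by
  have key : ∀ t ≥ T, f T + m * (t - T) ≤ f t := by
    intro t ht
    have := Convex.mul_sub_le_image_sub_of_le_deriv (convex_Ici T) (f := f) (C := m)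
      (fun x hx => (hf x hx).continuousAt.continuousWithinAt)
      (fun x hx => (hf x (interior_subset hx)).differentiableAt.differentiableWithinAt)
      (fun x hx => by
        rw [(hf x (interior_subset hx)).deriv]; exact hb x (interior_subset hx))
      T (Set.mem_Ici.2 le_rfl) t ht ht
    linarith
  have h1 : Tendsto (fun t => f T + m * (t - T)) atTop atTop := by
    apply tendsto_atTop_add_const_left
    apply Tendsto.const_mul_atTop hm
    exact tendsto_atTop_add_const_right _ _ tendsto_id
  apply tendsto_atTop_mono' _ _ h1
  filter_upwards [eventually_ge_atTop T] with t ht using key t ht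

/-- Negative slope motif with time-dependent inflows: for
`ȧ = k₁b(k* − a) + g_a(t)`, `ḃ = −k₁b(k* − a) + g_b(t)` with `k* = k₂/k₁`,
`G(t) = ∫₀ᵗ (g_a + g_b) → ∞` and `g_a(t)/G(t) → α ≥ 0`, every positive solution
satisfies `a(t) → k* + α/k₁`. -/
theorem stmt8 (k₁ k₂ ks : ℝ) (hk₁ : 0 < k₁) (hk₂ : 0 < k₂) (hks : ks = k₂ / k₁)
    (ga gb : ℝ → ℝ)
    (hga0 : ∀ t ≥ (0:ℝ), 0 ≤ ga t) (hgb0 : ∀ t ≥ (0:ℝ), 0 ≤ gb t)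
    (G : ℝ → ℝ) (hG : ∀ t, G t = ∫ s in (0:ℝ)..t, (ga s + gb s))
    (hGtop : Tendsto G atTop atTop)
    (α : ℝ) (hα0 : 0 ≤ α)
    (hαlim : Tendsto (fun t => ga t / G t) atTop (𝓝 α))
    (a b : ℝ → ℝ)
    (hapos : ∀ t ≥ (0:ℝ), 0 < a t) (hbpos : ∀ t ≥ (0:ℝ), 0 < b t)
    (ha : ∀ t ≥ (0:ℝ), HasDerivAt a (k₁ * b t * (ks - a t) + ga t) t)
    (hb : ∀ t ≥ (0:ℝ), HasDerivAt b (-(k₁ * b t * (ks - a t)) + gb t) t) :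
    Tendsto a atTop (𝓝 (ks + α / k₁)) := by
  have hks0 : 0 < ks := by rw [hks]; positivity
  have hGS : ∀ t ≥ (0:ℝ), G t = (a t + b t) - (a 0 + b 0) := by
    intro t ht
    have hd : ∀ x ≥ (0:ℝ), HasDerivAt (fun t => a t + b t) (ga x + gb x) x := by
      intro x hx
      exact ((ha x hx).add (hb x hx)).congr_deriv (by ring)
    rw [hG]
    apply intervalIntegral.integral_eq_sub_of_hasDerivAt (f := fun t => a t + b t)
    · intro x hx
      rw [Set.uIcc_of_le ht] at hx
      exact hd x hx.1
    · apply intervalIntegral.intervalIntegrable_deriv_of_nonneg (g := fun t => a t + b t)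
      · intro x hx
        rw [Set.uIcc_of_le ht] at hx
        exact (hd x hx.1).continuousAt.continuousWithinAt
      · intro x hx
        rw [min_eq_left ht] at hx
        exact hd x hx.1.le
      · intro x hx
        rw [min_eq_left ht] at hx
        exact add_nonneg (hga0 x hx.1.le) (hgb0 x hx.1.le)
  have hS0 : 0 < a 0 + b 0 := add_pos (hapos 0 le_rfl) (hbpos 0 le_rfl)
  set S0 := a 0 + b 0 with hS0def
  obtain ⟨L, hL⟩ : ∃ L, L = ks + α / k₁ := ⟨_, rfl⟩
  have hkL : k₁ * (L - ks) = α := by rw [hL]; field_simp; ring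
  have hL0 : 0 < L := by rw [hL]; positivity
  rw [← hL]
  -- bounds
  have hbd : ∀ m > 0, ∀ K : ℝ, ∃ T ≥ (0:ℝ), ∀ t ≥ T, K ≤ G t ∧ 0 < G t ∧
      ga t ≤ (α + m) * (a t + b t) ∧ (α - m) * G t ≤ ga t := by
    intro m hm K
    have h1 := hαlim.eventually (Ioo_mem_nhds (show α - m < α by linarith)
      (show α < α + m by linarith))
    have h2 := h1.and ((hGtop.eventually_ge_atTop K).and ((hGtop.eventually_gt_atTop 0).and
      (eventually_ge_atTop (0:ℝ))))
    obtain ⟨T, hT⟩ := eventually_atTop.1 h2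
    refine ⟨max T 0, le_max_right _ _, fun t ht => ?_⟩
    obtain ⟨⟨h3, h4⟩, h5, h6, h7⟩ := hT t ((le_max_left _ _).trans ht)
    rw [lt_div_iff₀ h6] at h3
    rw [div_lt_iff₀ h6] at h4
    refine ⟨h5, h6, ?_, h3.le⟩
    have := hGS t h7
    nlinarith
  have hupper : ∀ ε > 0, ∀ᶠ t in atTop, a t ≤ L + ε := by
    intro ε hε
    obtain ⟨m, hm⟩ : ∃ m, m = k₁ * ε / 2 := ⟨_, rfl⟩
    have hm0 : 0 < m := by rw [hm]; positivity
    obtain ⟨T, hT0, hT⟩ := hbd m hm0 (((α + m) * (L + ε)) / m + (L + ε))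
    have hub : ∀ t ≥ T, L + ε ≤ a t →
        k₁ * b t * (ks - a t) + ga t ≤ (α + m) * a t - m * b t := by
      intro t ht hat
      have h1 := (hT t ht).2.2.1
      have hb0 := hbpos t (hT0.trans ht)
      have h2 : α + 2 * m ≤ k₁ * (a t - ks) := by
        have : k₁ * (L + ε - ks) ≤ k₁ * (a t - ks) :=
          mul_le_mul_of_nonneg_left (by linarith) hk₁.le
        rw [hm]; linarith
      have h3 := mul_le_mul_of_nonneg_right h2 hb0.le
      linarith
    refine aux_trap a _ T (L + ε) (fun t ht => ha t (hT0.trans ht)) ?_ ?_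
    · intro t ht hat
      refine lt_of_le_of_lt (hub t ht hat.ge) ?_
      have h1 := (hT t ht).1
      rw [hGS t (hT0.trans ht)] at h1
      have h2 : (α + m) * (L + ε) / m < b t := by linarith
      rw [div_lt_iff₀ hm0] at h2
      rw [hat]; linarith
    · by_contra! hcon
      have hlb : ∀ t ≥ T, HasDerivAt (fun t => Real.log (b t))
          ((-(k₁ * b t * (ks - a t)) + gb t) / b t) t := fun t ht =>
        (hb t (hT0.trans ht)).log (hbpos t (hT0.trans ht)).ne'
      have hla : ∀ t ≥ T, HasDerivAt (fun t => Real.log (a t))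
          ((k₁ * b t * (ks - a t) + ga t) / a t) t := fun t ht =>
        (ha t (hT0.trans ht)).log (hapos t (hT0.trans ht)).ne'
      have hla' : ∀ t ≥ T, (k₁ * b t * (ks - a t) + ga t) / a t ≤ (α + m) - m * (b t / a t) := by
        intro t ht
        have ha0 := hapos t (hT0.trans ht)
        rw [div_le_iff₀ ha0]
        have := hub t ht (hcon t ht).le
        have e : ((α + m) - m * (b t / a t)) * a t = (α + m) * a t - m * b t := by
          field_simp
        rw [e]; exact this
      have hu : Tendsto (fun t => Real.log (b t) - Real.log (a t)) atTop atTop := by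
        refine aux_grow _ _ T m hm0 (fun t ht => (hlb t ht).sub (hla t ht)) ?_
        intro t ht
        have ha0 := hapos t (hT0.trans ht)
        have hb0 := hbpos t (hT0.trans ht)
        have h1 := hla' t ht
        have h2 : 0 < m * (b t / a t) := by positivity
        have h3 : α + 2 * m ≤ (-(k₁ * b t * (ks - a t)) + gb t) / b t := by
          rw [le_div_iff₀ hb0]
          have h2 : α + 2 * m ≤ k₁ * (a t - ks) := by
            have : k₁ * (L + ε - ks) ≤ k₁ * (a t - ks) :=
              mul_le_mul_of_nonneg_left (by linarith [hcon t ht]) hk₁.le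
            rw [hm]; linarith
          have h3 := mul_le_mul_of_nonneg_right h2 hb0.le
          have := hgb0 t (hT0.trans ht)
          linarith
        linarith
      obtain ⟨T1, hT1⟩ := eventually_atTop.1 (hu.eventually_ge_atTop ((α + m + 1) / m))
      have hneg : Tendsto (fun t => - Real.log (a t)) atTop atTop := by
        refine aux_grow _ _ (max T T1) 1 one_pos
          (fun t ht => (hla t ((le_max_left _ _).trans ht)).neg) ?_
        intro t ht
        have htT := (le_max_left _ _).trans ht
        have ha0 := hapos t (hT0.trans htT)
        have hb0 := hbpos t (hT0.trans htT)
        have h1 := hla' t htT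
        have h2 := hT1 t ((le_max_right _ _).trans ht)
        rw [← Real.log_div hb0.ne' ha0.ne'] at h2
        have h3 := Real.log_le_sub_one_of_pos (div_pos hb0 ha0)
        have h4 : (α + m + 1) / m ≤ b t / a t := by linarith
        rw [div_le_iff₀ hm0] at h4
        linarith
      obtain ⟨t, ht1, ht2⟩ := ((hneg.eventually_gt_atTop (- Real.log (L + ε))).and
        (eventually_ge_atTop T)).exists
      have := Real.log_le_log (by linarith) (hcon t ht2).le
      linarith
  have hlower : ∀ ε > 0, ∀ᶠ t in atTop, L - ε ≤ a t := by
    intro ε hε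
    obtain ⟨m, hm⟩ : ∃ m, m = k₁ * ε / 2 := ⟨_, rfl⟩
    have hm0 : 0 < m := by rw [hm]; positivity
    obtain ⟨T, hT0, hT⟩ := hbd m hm0 (L + (1 + |2 * m - α| * (L + S0)) / m)
    have hub : ∀ t ≥ T, a t ≤ L - ε → 1 ≤ k₁ * b t * (ks - a t) + ga t := by
      intro t ht hat
      obtain ⟨h1, h2, -, h3⟩ := hT t ht
      have hb0 := hbpos t (hT0.trans ht)
      have ha0 := hapos t (hT0.trans ht)
      have hg := hGS t (hT0.trans ht)
      have h4 : 2 * m - α ≤ k₁ * (ks - a t) := by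
        have : k₁ * (ks - (L - ε)) ≤ k₁ * (ks - a t) :=
          mul_le_mul_of_nonneg_left (by linarith) hk₁.le
        rw [hm]; linarith
      have h5 := mul_le_mul_of_nonneg_right h4 hb0.le
      have h6 : (1 + |2 * m - α| * (L + S0)) / m ≤ G t := by linarith
      rw [div_le_iff₀ hm0] at h6
      have h7 : (2 * m - α) * G t - |2 * m - α| * (L + S0) ≤ (2 * m - α) * b t := by
        have : (2 * m - α) * (G t - b t) ≤ |2 * m - α| * (L + S0) := by
          refine (le_abs_self _).trans ?_
          rw [abs_mul]
          apply mul_le_mul_of_nonneg_left _ (abs_nonneg _)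
          rw [abs_le]; constructor <;> linarith
        linarith
      linarith
    have := aux_trap (fun t => - a t) _ T (-(L - ε)) (fun t ht => (ha t (hT0.trans ht)).neg) ?_ ?_
    · filter_upwards [this] with t ht
      linarith
    · intro t ht hat
      have := hub t ht (by linarith)
      linarith
    · by_contra! hcon
      have h1 := aux_grow a _ T 1 one_pos (fun t ht => ha t (hT0.trans ht))
        (fun t ht => hub t ht (by linarith [hcon t ht]))
      obtain ⟨t, ht1, ht2⟩ := ((h1.eventually_gt_atTop (L - ε)).and
        (eventually_ge_atTop T)).exists
      linarith [hcon t ht2]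
  rw [Metric.tendsto_nhds]
  intro ε hε
  filter_upwards [hupper (ε / 2) (by linarith), hlower (ε / 2) (by linarith)] with t h1 h2
  rw [Real.dist_eq, abs_lt]
  constructor <;> linarith
end

section
/- (Negative slope motif with polynomial inflow.) Let k₁, k₂ > 0 and k* = k₂/k₁. Let g_a : ℝ_{≥0} → ℝ_{≥0} be a polynomial function of t taking only positive values (this includes constant positive inflow), and let g_b : ℝ_{≥0} → ℝ_{≥0} be arbitrary. Let a, b : [0,∞) → ℝ_{>0} be differentiable with (a(0), b(0)) in the open positive quadrant, satisfying ȧ(t) = k₁·b(t)·(k* − a(t)) + g_a(t) and ḃ(t) = −k₁·b(t)·(k* − a(t)) + g_b(t). Then a(t) → k* as t → ∞. -/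
open Filter MeasureTheory Topology

lemma aux_mono (f f' : ℝ → ℝ) (T : ℝ) (hf : ∀ t ≥ T, HasDerivAt f (f' t) t)
    (h : ∀ t ≥ T, 0 ≤ f' t) (t : ℝ) (ht : T ≤ t) : f T ≤ f t := by
  have := monotoneOn_of_deriv_nonneg (convex_Ici T)
    (f := f) (fun x hx => (hf x hx).continuousAt.continuousWithinAt)
    (fun x hx => by
      rw [interior_Ici] at hx
      exact (hf x (le_of_lt hx)).differentiableAt.differentiableWithinAt)
    (fun x hx => by
      rw [interior_Ici] at hx
      rw [(hf x (le_of_lt hx)).deriv]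
      exact h x (le_of_lt hx))
  exact this (Set.mem_Ici.2 le_rfl) (Set.mem_Ici.2 ht) ht

lemma aux_barrier (f f' : ℝ → ℝ) (T c : ℝ) (hc : 0 < c)
    (hf : ∀ t ≥ T, HasDerivAt f (f' t) t)
    (h : ∀ t ≥ T, 0 ≤ f t → f' t ≤ -c) : ∃ S ≥ T, ∀ t ≥ S, f t ≤ 0 := by
  have h1 : ∃ S ≥ T, f S ≤ 0 := by
    by_contra! hn
    have key := aux_mono (fun t => -f t - c * t) (fun t => -f' t - c * 1) T
      (fun t ht => (hf t ht).neg.sub ((hasDerivAt_id t).const_mul c))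
      (fun t ht => by have := h t ht (hn t ht).le; linarith)
    have hT := hn T le_rfl
    have ht : T ≤ T + f T / c := by have := div_pos hT hc; linarith
    have h2 := key _ ht
    have h3 := hn _ ht
    have h4 : c * (f T / c) = f T := by field_simp
    simp only [mul_add, h4] at h2
    linarith
  obtain ⟨S, hS, hfS⟩ := h1
  refine ⟨S, hS, fun t ht => ?_⟩
  refine image_le_of_deriv_right_lt_deriv_boundary' (f := f) (f' := f') (a := S) (b := t)
    (B := fun _ => 0) (B' := fun _ => 0)
    (fun x hx => (hf x (hS.le.trans hx.1)).continuousAt.continuousWithinAt)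
    (fun x hx => (hf x (hS.le.trans hx.1)).hasDerivWithinAt) hfS continuousOn_const
    (fun x _ => hasDerivWithinAt_const _ _ _) (fun x hx hx0 => ?_) (Set.right_mem_Icc.2 ht)
  have := h x (hS.le.trans hx.1) hx0.ge
  linarith

/-- Negative slope motif with polynomial inflow: for
`ȧ = k₁b(k* − a) + g_a(t)`, `ḃ = −k₁b(k* − a) + g_b(t)` with `k* = k₂/k₁`, where
`g_a` is a polynomial taking only positive values (on `t ≥ 0`) and `g_b` is an
arbitrary nonnegative inflow, every positive solution satisfies `a(t) → k*`. -/
theorem stmt9 (k₁ k₂ ks : ℝ) (hk₁ : 0 < k₁) (hk₂ : 0 < k₂) (hks : ks = k₂ / k₁)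
    (ga gb : ℝ → ℝ)
    (p : Polynomial ℝ) (hpoly : ∀ t ≥ (0:ℝ), ga t = p.eval t)
    (hgapos : ∀ t ≥ (0:ℝ), 0 < ga t)
    (hgb0 : ∀ t ≥ (0:ℝ), 0 ≤ gb t)
    (a b : ℝ → ℝ)
    (hapos : ∀ t ≥ (0:ℝ), 0 < a t) (hbpos : ∀ t ≥ (0:ℝ), 0 < b t)
    (ha : ∀ t ≥ (0:ℝ), HasDerivAt a (k₁ * b t * (ks - a t) + ga t) t)
    (hb : ∀ t ≥ (0:ℝ), HasDerivAt b (-(k₁ * b t * (ks - a t)) + gb t) t) :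
    Tendsto a atTop (𝓝 ks) := by
  have hp0 : p ≠ 0 := by
    rintro rfl
    have h1 := hgapos 0 le_rfl
    rw [hpoly 0 le_rfl] at h1
    simp at h1
  have hppos : ∀ t ≥ (0:ℝ), 0 < p.eval t := fun t ht => hpoly t ht ▸ hgapos t ht
  -- polynomial estimates
  have e1 : ∃ C > 0, ∀ᶠ t in atTop, 1 ≤ C * p.eval t := by
    have := Polynomial.isBigO_atTop_of_degree_le (P := (1 : Polynomial ℝ)) (Q := p)
      (by rw [Polynomial.degree_one]; exact Polynomial.zero_le_degree_iff.2 hp0)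
    obtain ⟨C, hC, h⟩ := this.exists_pos
    refine ⟨C, hC, ?_⟩
    filter_upwards [h.bound, eventually_ge_atTop 0] with t h1 h2
    rw [Real.norm_of_nonneg (hppos t h2).le] at h1
    simpa using h1
  have e2 : ∃ C > 0, ∀ᶠ t in atTop, t * |p.derivative.eval t| ≤ C * p.eval t := by
    have := Polynomial.isBigO_atTop_of_degree_le (P := Polynomial.X * p.derivative) (Q := p)
      (by
        by_cases hd : p.derivative = 0
        · simp [hd]
        · have hdeg : 0 < p.natDegree := by
            by_contra hcon
            exact hd (Polynomial.derivative_of_natDegree_zero (by omega))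
          have hlt := Polynomial.natDegree_derivative_lt hdeg.ne'
          rw [Polynomial.degree_eq_natDegree hp0,
            ← Polynomial.natDegree_le_iff_degree_le, Polynomial.natDegree_X_mul hd]
          omega)
    obtain ⟨C, hC, h⟩ := this.exists_pos
    refine ⟨C, hC, ?_⟩
    filter_upwards [h.bound, eventually_ge_atTop 0] with t h1 h2
    rw [Real.norm_of_nonneg (hppos t h2).le] at h1
    simpa [abs_mul, abs_of_nonneg h2] using h1
  obtain ⟨C, hC, hC1⟩ := e1
  obtain ⟨D, hD, hD1⟩ := e2
  obtain ⟨T0, hT0⟩ := eventually_atTop.1 (hC1.and (hD1.and (eventually_ge_atTop (0:ℝ))))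
  have hlow : ∀ t ≥ T0, C⁻¹ ≤ p.eval t := fun t ht => by
    rw [inv_le_iff_one_le_mul₀' hC]; exact (hT0 t ht).1
  have hT00 : 0 ≤ T0 := (hT0 T0 le_rfl).2.2
  -- step 1
  obtain ⟨T1, hT1, hx⟩ := aux_barrier (fun t => ks - a t)
    (fun t => -(k₁ * b t * (ks - a t) + ga t)) T0 C⁻¹ (inv_pos.2 hC)
    (fun t ht => (ha t (hT00.trans ht)).const_sub ks)
    (fun t ht h => by
      have h0 : 0 ≤ t := hT00.trans ht
      have h1 := hlow t ht
      have h2 : 0 ≤ k₁ * b t * (ks - a t) :=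
        mul_nonneg (mul_pos hk₁ (hbpos t h0)).le h
      rw [hpoly t h0]; linarith)
  have hT10 : 0 ≤ T1 := hT00.trans hT1
  have hbm := aux_mono b (fun t => -(k₁ * b t * (ks - a t)) + gb t) T1
    (fun t ht => hb t (hT10.trans ht))
    (fun t ht => by
      have h0 : 0 ≤ t := hT10.trans ht
      have h2 : k₁ * b t * (ks - a t) ≤ 0 :=
        mul_nonpos_of_nonneg_of_nonpos (mul_pos hk₁ (hbpos t h0)).le (hx t ht)
      have := hgb0 t h0
      linarith)
  -- step 2
  set β := k₁ * b T1 with hβ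
  have hβ0 : 0 < β := mul_pos hk₁ (hbpos T1 hT10)
  obtain ⟨T2, hT2, hy⟩ := aux_barrier (fun t => a t - ks - 2 / β * p.eval t - 1)
    (fun t => k₁ * b t * (ks - a t) + ga t - 2 / β * p.derivative.eval t)
    (max T1 (2 * D / β)) β hβ0
    (fun t ht => (((ha t (hT10.trans ((le_max_left _ _).trans ht))).sub_const ks).sub
      ((p.hasDerivAt t).const_mul (2 / β))).sub_const 1)
    (fun t ht h => by
      have ht1 : T1 ≤ t := (le_max_left _ _).trans ht
      have ht2 : 2 * D / β ≤ t := (le_max_right _ _).trans ht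
      have h0 : 0 ≤ t := hT10.trans ht1
      have hd := (hT0 t (hT1.le.trans ht1)).2.1
      have hp := hppos t h0
      have hbb := hbm t ht1
      have hxx := hx t ht1
      rw [hpoly t h0]
      have ht3 : 0 < 2 * D / β := by positivity
      have hd2 : 2 / β * |p.derivative.eval t| ≤ p.eval t := by
        have : 2 * D / β * |p.derivative.eval t| ≤ D * p.eval t :=
          (mul_le_mul_of_nonneg_right ht2 (abs_nonneg _)).trans hd
        have h5 : D * (2 / β * |p.derivative.eval t|) ≤ D * p.eval t := by
          calc _ = 2 * D / β * |p.derivative.eval t| := by ring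
            _ ≤ _ := this
        exact le_of_mul_le_mul_left h5 hD
      have hd3 : -(2 / β * p.derivative.eval t) ≤ 2 / β * |p.derivative.eval t| := by
        rw [← mul_neg]
        exact mul_le_mul_of_nonneg_left (neg_le_abs _) (by positivity)
      have h6 : β * (a t - ks) ≤ k₁ * b t * (a t - ks) :=
        mul_le_mul_of_nonneg_right (mul_le_mul_of_nonneg_left hbb hk₁.le) (by linarith)
      have h7 : β * (2 / β * p.eval t + 1) ≤ β * (a t - ks) :=
        mul_le_mul_of_nonneg_left (by linarith) hβ0.le
      have h8 : β * (2 / β * p.eval t + 1) = 2 * p.eval t + β := by field_simp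
      linarith)
  have hT21 : T1 ≤ T2 := (le_max_left _ _).trans hT2
  have hT20 : 0 ≤ T2 := hT10.trans hT21
  -- step 3
  have hh := aux_mono (fun t => b t + a t - (D + 1)⁻¹ * (t * p.eval t))
    (fun t => (-(k₁ * b t * (ks - a t)) + gb t) + (k₁ * b t * (ks - a t) + ga t)
      - (D + 1)⁻¹ * (1 * p.eval t + t * p.derivative.eval t)) T2
    (fun t ht => ((hb t (hT20.trans ht)).add (ha t (hT20.trans ht))).sub
      (((hasDerivAt_id t).mul (p.hasDerivAt t)).const_mul _))
    (fun t ht => by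
      have h0 : 0 ≤ t := hT20.trans ht
      have hd := (hT0 t (hT1.le.trans (hT21.trans ht))).2.1
      have hg := hgb0 t h0
      rw [hpoly t h0]
      have h1 : t * p.derivative.eval t ≤ t * |p.derivative.eval t| :=
        mul_le_mul_of_nonneg_left (le_abs_self _) h0
      have h2 : (D + 1)⁻¹ * (1 * p.eval t + t * p.derivative.eval t) ≤ p.eval t := by
        rw [inv_mul_le_iff₀ (by positivity)]; linarith
      linarith)
  set K := b T2 + a T2 - (D + 1)⁻¹ * (T2 * p.eval T2) with hK
  have hbig : ∀ N : ℝ, ∃ S ≥ T2, ∀ t ≥ S, N * p.eval t ≤ b t := by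
    intro N
    refine ⟨max T2 ((D + 1) * (2 / β + N + |1 + ks - K| * C)), le_max_left _ _, fun t ht => ?_⟩
    have ht1 : T2 ≤ t := (le_max_left _ _).trans ht
    have ht2 := (le_max_right _ _).trans ht
    have h0 : 0 ≤ t := hT20.trans ht1
    have hp := hppos t h0
    have h1 := hh t ht1
    have h2 := hy t ht1
    have h3 := (hT0 t (hT1.le.trans (hT21.trans ht1))).1
    have h4 : 2 / β + N + |1 + ks - K| * C ≤ (D + 1)⁻¹ * t := by
      rw [le_inv_mul_iff₀ (by positivity)]; exact ht2
    have h5 := mul_le_mul_of_nonneg_right h4 hp.le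
    have h6 := mul_le_mul_of_nonneg_left h3 (abs_nonneg (1 + ks - K))
    have h7 := le_abs_self (1 + ks - K)
    have h8 : (D + 1)⁻¹ * t * p.eval t = (D + 1)⁻¹ * (t * p.eval t) := by ring
    nlinarith
  -- step 4
  rw [Metric.tendsto_atTop]
  intro ε hε
  obtain ⟨S, hS, hN⟩ := hbig (2 / (k₁ * (ε / 2)))
  have hS1 : T1 ≤ S := hT21.trans hS
  obtain ⟨R, hR, hfin⟩ := aux_barrier (fun t => a t - ks - ε / 2)
    (fun t => k₁ * b t * (ks - a t) + ga t) S C⁻¹ (inv_pos.2 hC)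
    (fun t ht => ((ha t (hT10.trans (hS1.trans ht))).sub_const ks).sub_const _)
    (fun t ht h => by
      have ht1 : T1 ≤ t := hS1.trans ht
      have h0 : 0 ≤ t := hT10.trans ht1
      have h1 := hN t ht
      have h2 := hlow t (hT1.le.trans ht1)
      have hp := hppos t h0
      rw [hpoly t h0]
      have h3 : k₁ * b t * (ε / 2) ≤ k₁ * b t * (a t - ks) :=
        mul_le_mul_of_nonneg_left (by linarith) (mul_pos hk₁ (hbpos t h0)).le
      have h4 := mul_le_mul_of_nonneg_left h1 (show 0 ≤ k₁ * (ε / 2) by positivity)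
      have h5 : k₁ * (ε / 2) * (2 / (k₁ * (ε / 2)) * p.eval t) = 2 * p.eval t := by
        field_simp
      nlinarith)
  refine ⟨R, fun t ht => ?_⟩
  have h1 := hfin t ht
  have h2 := hx t (hS1.trans (hR.le.trans ht))
  rw [Real.dist_eq, abs_lt]
  constructor <;> linarith
end

section
/- (Explicit solution of the negative slope motif with inflow in A only.) Let k₁ > 0, k ∈ ℝ, let g_a : ℝ_{≥0} → ℝ be continuous and set G_a(t) = ∫₀ᵗ g_a(s) ds. Fix initial values a₀ ≥ 0 and b₀ ≥ 0. Define q(t) = exp[ k₁(a₀+b₀−k)t + k₁ ∫₀ᵗ G_a(s) ds ] and Q(t) = ∫₀ᵗ q(s) ds. Then the function a(t) = a₀ + b₀ + G_a(t) − b₀·q(t)/(1 + k₁ b₀ Q(t)) satisfies a(0) = a₀ and solves the differential equation ȧ(t) = −k₁·(a(t) − k)·(a₀ + b₀ + G_a(t) − a(t)) + g_a(t) for all t ≥ 0. -/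
open Filter MeasureTheory Topology

/-- Explicit solution of the negative slope motif with inflow in `A`
only: with `G_a(t) = ∫₀ᵗ g_a`, `q(t) = exp(k₁(a₀+b₀−k)t + k₁∫₀ᵗ G_a)` and
`Q(t) = ∫₀ᵗ q`, the function `a(t) = a₀ + b₀ + G_a(t) − b₀ q(t)/(1 + k₁ b₀ Q(t))`
satisfies `a(0) = a₀` and solves `ȧ = −k₁(a − k)(a₀ + b₀ + G_a(t) − a) + g_a(t)`. -/
theorem stmt10 (k₁ k : ℝ) (hk₁ : 0 < k₁)
    (ga : ℝ → ℝ) (hga : Continuous ga)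
    (a₀ b₀ : ℝ) (ha₀ : 0 ≤ a₀) (hb₀ : 0 ≤ b₀)
    (Ga q Q a : ℝ → ℝ)
    (hGa : ∀ t, Ga t = ∫ s in (0:ℝ)..t, ga s)
    (hq : ∀ t, q t = Real.exp (k₁ * (a₀ + b₀ - k) * t + k₁ * ∫ s in (0:ℝ)..t, Ga s))
    (hQ : ∀ t, Q t = ∫ s in (0:ℝ)..t, q s)
    (ha : ∀ t, a t = a₀ + b₀ + Ga t - b₀ * q t / (1 + k₁ * b₀ * Q t)) :
    a 0 = a₀ ∧
    ∀ t ≥ (0:ℝ),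
      HasDerivAt a (-(k₁ * (a t - k) * (a₀ + b₀ + Ga t - a t)) + ga t) t := by
  have ftc : ∀ f : ℝ → ℝ, Continuous f → ∀ t, HasDerivAt (fun t => ∫ s in (0:ℝ)..t, f s) (f t) t :=
    fun f hf t => intervalIntegral.integral_hasDerivAt_right (hf.intervalIntegrable _ _)
      (hf.stronglyMeasurableAtFilter _ _) hf.continuousAt
  have dGa : ∀ t, HasDerivAt Ga (ga t) t := by
    rw [funext hGa]; exact ftc ga hga
  have cGa : Continuous Ga := continuous_iff_continuousAt.2 fun t => (dGa t).continuousAt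
  have dq : ∀ t, HasDerivAt q (q t * (k₁ * (a₀ + b₀ - k) + k₁ * Ga t)) t := by
    intro t
    have h := ((((hasDerivAt_id t).const_mul (k₁ * (a₀ + b₀ - k))).add
      ((ftc Ga cGa t).const_mul k₁)).exp)
    have e : q = fun t => Real.exp (k₁ * (a₀ + b₀ - k) * t + k₁ * ∫ s in (0:ℝ)..t, Ga s) :=
      funext hq
    rw [e]
    refine HasDerivAt.congr_deriv (f := fun t => Real.exp (k₁ * (a₀ + b₀ - k) * t + k₁ * ∫ s in (0:ℝ)..t, Ga s)) h ?_
    simp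
  have cq : Continuous q := continuous_iff_continuousAt.2 fun t => (dq t).continuousAt
  have dQ : ∀ t, HasDerivAt Q (q t) t := by
    rw [funext hQ]; exact ftc q cq
  refine ⟨?_, ?_⟩
  · have h1 : Ga 0 = 0 := by rw [hGa]; simp
    have h2 : Q 0 = 0 := by rw [hQ]; simp
    have h3 : q 0 = 1 := by rw [hq]; simp
    rw [ha, h1, h2, h3]; simp
  · intro t ht
    have hQ0 : 0 ≤ Q t := by
      rw [hQ]
      exact intervalIntegral.integral_nonneg ht fun s _ => by rw [hq]; positivity
    have hD : 1 + k₁ * b₀ * Q t ≠ 0 := by positivity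
    have h := ((dGa t).const_add (a₀ + b₀)).sub
      (((dq t).const_mul b₀).div (((dQ t).const_mul (k₁ * b₀)).const_add 1) hD)
    have h2 := h.congr_of_eventuallyEq (f₁ := a) (Eventually.of_forall fun t => ha t)
    refine h2.congr_deriv ?_
    rw [ha t]
    field_simp
    ring
end

section
/- (Higher-order negative slope motif: robustness to bounded inflow.) Let k₁, k₂ > 0 and k* = k₂/k₁. Let g_a, g_b : ℝ_{≥0} → ℝ_{≥0} with G(t) := ∫₀ᵗ (g_a(s) + g_b(s)) ds → ∞ as t → ∞, and assume g_a is bounded. Let a, b : [0,∞) → ℝ_{>0} be differentiable with (a(0), b(0)) in the open positive quadrant, satisfying ȧ(t) = k₁·b(t)²·(k* − a(t)) + g_a(t) and ḃ(t) = −k₁·b(t)²·(k* − a(t)) + g_b(t). Then a(t) → k* as t → ∞. -/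
open Filter MeasureTheory Topology

lemma grow_aux (f f' : ℝ → ℝ) (T c : ℝ)
    (hf : ∀ t ≥ T, HasDerivAt f (f' t) t) (hc : ∀ t ≥ T, c ≤ f' t) (t : ℝ) (ht : T ≤ t) :
    f T + c * (t - T) ≤ f t := by
  have h := Convex.mul_sub_le_image_sub_of_le_deriv (convex_Icc T t) (f := f) (C := c)
    (fun x hx => (hf x hx.1).continuousAt.continuousWithinAt)
    (fun x hx => by
      rw [interior_Icc] at hx
      exact (hf x hx.1.le).differentiableAt.differentiableWithinAt)
    (fun x hx => by
      rw [interior_Icc] at hx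
      rw [(hf x hx.1.le).deriv]; exact hc x hx.1.le)
    T ⟨le_refl _, ht⟩ t ⟨ht, le_refl _⟩ ht
  linarith

lemma grow_false (f f' : ℝ → ℝ) (T c C : ℝ) (hc0 : 0 < c)
    (hf : ∀ t ≥ T, HasDerivAt f (f' t) t) (hc : ∀ t ≥ T, c ≤ f' t)
    (hC : ∀ t ≥ T, f t ≤ C) : False := by
  have h0 := hC T le_rfl
  have hd : 0 ≤ (C - f T + 1) / c := div_nonneg (by linarith) hc0.le
  have hT : T ≤ T + (C - f T + 1) / c := by linarith
  have h1 := grow_aux f f' T c hf hc _ hT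
  have h2 := hC _ hT
  have h3 : c * (T + (C - f T + 1) / c - T) = C - f T + 1 := by field_simp; ring
  linarith

lemma barrier_aux (f f' : ℝ → ℝ) (T B : ℝ)
    (hf : ∀ t ≥ T, HasDerivAt f (f' t) t) (h0 : f T ≤ B)
    (hB : ∀ t ≥ T, f t = B → f' t < 0) (t : ℝ) (ht : T ≤ t) : f t ≤ B :=
  image_le_of_deriv_right_lt_deriv_boundary' (f := f) (f' := f') (a := T) (b := t)
    (B := fun _ => B) (B' := fun _ => 0)
    (fun x hx => (hf x hx.1).continuousAt.continuousWithinAt)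
    (fun x hx => (hf x hx.1).hasDerivWithinAt) h0 continuousOn_const
    (fun x _ => hasDerivWithinAt_const _ _ _)
    (fun x hx h => hB x hx.1 h) ⟨ht, le_refl _⟩

/-- Higher-order negative slope motif, bounded inflow: for
`ȧ = k₁b²(k* − a) + g_a(t)`, `ḃ = −k₁b²(k* − a) + g_b(t)` with `k* = k₂/k₁`,
`G(t) = ∫₀ᵗ (g_a + g_b) → ∞` and `g_a` bounded, every positive solution satisfies
`a(t) → k*`. -/
theorem stmt14 (k₁ k₂ ks : ℝ) (hk₁ : 0 < k₁) (hk₂ : 0 < k₂) (hks : ks = k₂ / k₁)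
    (ga gb : ℝ → ℝ)
    (hga0 : ∀ t ≥ (0:ℝ), 0 ≤ ga t) (hgb0 : ∀ t ≥ (0:ℝ), 0 ≤ gb t)
    (G : ℝ → ℝ) (hG : ∀ t, G t = ∫ s in (0:ℝ)..t, (ga s + gb s))
    (hGtop : Tendsto G atTop atTop)
    (hbound : ∃ M : ℝ, ∀ t ≥ (0:ℝ), ga t ≤ M)
    (a b : ℝ → ℝ)
    (hapos : ∀ t ≥ (0:ℝ), 0 < a t) (hbpos : ∀ t ≥ (0:ℝ), 0 < b t)
    (ha : ∀ t ≥ (0:ℝ), HasDerivAt a (k₁ * (b t) ^ 2 * (ks - a t) + ga t) t)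
    (hb : ∀ t ≥ (0:ℝ), HasDerivAt b (-(k₁ * (b t) ^ 2 * (ks - a t)) + gb t) t) :
    Tendsto a atTop (𝓝 ks) := by
  obtain ⟨M, hM⟩ := hbound
  have hs : ∀ t ≥ (0:ℝ), HasDerivAt (fun t => a t + b t) (ga t + gb t) t := by
    intro t ht
    exact ((ha t ht).fun_add (hb t ht)).congr_deriv (by ring)
  -- the total mass tends to infinity
  have hlarge : ∀ C : ℝ, ∃ T ≥ (0:ℝ), ∀ t ≥ T, C ≤ a t + b t := by
    intro C
    obtain ⟨T, hT⟩ := eventually_atTop.1 (hGtop.eventually_ge_atTop (max C 1))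
    refine ⟨max T 0, le_max_right _ _, fun t ht => ?_⟩
    have ht0 : 0 ≤ t := (le_max_right _ _).trans ht
    have h1 := hT t ((le_max_left _ _).trans ht)
    have hCG : C ≤ G t := (le_max_left _ _).trans h1
    have h1G : 1 ≤ G t := (le_max_right _ _).trans h1
    have hint : IntervalIntegrable (fun s => ga s + gb s) volume 0 t := by
      by_contra hn
      rw [hG, intervalIntegral.integral_undef hn] at h1G
      linarith
    have := intervalIntegral.integral_eq_sub_of_hasDerivAt
      (f := fun t => a t + b t) (fun x hx => hs x (by
        rw [Set.uIcc_of_le ht0] at hx; exact hx.1)) hint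
    rw [← hG] at this
    have h2 := hapos 0 le_rfl
    have h3 := hbpos 0 le_rfl
    linarith
  have hupper : ∀ ε > 0, ∃ T, ∀ t ≥ T, a t ≤ ks + ε := by
    intro ε hε
    set R := max 1 ((M + 1) / (k₁ * ε)) with hR
    obtain ⟨T, hT0, hT⟩ := hlarge (ks + ε + R)
    have hex : ∃ t₀ ≥ T, a t₀ ≤ ks + ε := by
      by_contra hcon
      push Not at hcon
      refine grow_false (fun t => -(b t)⁻¹)
        (fun t => -(-(-(k₁ * (b t) ^ 2 * (ks - a t)) + gb t) / (b t) ^ 2)) T (k₁ * ε) 0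
        (by positivity)
        (fun t ht => ((hb t (hT0.trans ht)).fun_inv (hbpos t (hT0.trans ht)).ne').fun_neg) ?_ ?_
      · intro t ht
        have hbt := hbpos t (hT0.trans ht)
        have hg := hgb0 t (hT0.trans ht)
        have hat := hcon t ht
        rw [← neg_div, neg_neg, le_div_iff₀ (by positivity)]
        have : 0 < k₁ * b t ^ 2 * (a t - ks - ε) := mul_pos (by positivity) (by linarith)
        nlinarith
      · intro t ht
        have hbt := hbpos t (hT0.trans ht)
        have := inv_pos.2 hbt
        linarith
    obtain ⟨t₀, ht₀, hat₀⟩ := hex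
    refine ⟨t₀, barrier_aux a _ t₀ (ks + ε) (fun t ht => ha t (hT0.trans (ht₀.trans ht))) hat₀ ?_⟩
    intro t ht hat
    have h1 := hT t (ht₀.trans ht)
    have h2 := hM t (hT0.trans (ht₀.trans ht))
    have hbR : R ≤ b t := by linarith
    have hR1 : 1 ≤ R := le_max_left _ _
    have hR2 : (M + 1) / (k₁ * ε) ≤ R := le_max_right _ _
    have hb2 : R ≤ b t ^ 2 := by nlinarith
    have h3 := (div_le_iff₀ (by positivity)).1 (hR2.trans hb2)
    rw [hat]
    nlinarith
  have hlower : ∀ ε > 0, ∃ T, ∀ t ≥ T, ks - ε ≤ a t := by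
    intro ε hε
    obtain ⟨T, hT0, hT⟩ := hlarge (ks + 1)
    have hex : ∃ t₀ ≥ T, ks - ε ≤ a t₀ := by
      by_contra hcon
      push Not at hcon
      refine grow_false a _ T (k₁ * ε) (ks - ε) (by positivity)
        (fun t ht => ha t (hT0.trans ht)) ?_ (fun t ht => (hcon t ht).le)
      intro t ht
      have hat := hcon t ht
      have h1 := hT t ht
      have hg := hga0 t (hT0.trans ht)
      have hb1 : 1 ≤ b t := by linarith
      have hb2 : 1 ≤ b t ^ 2 := by nlinarith
      have h4 : k₁ * 1 * ε ≤ k₁ * b t ^ 2 * (ks - a t) := by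
        gcongr
        linarith
      linarith
    obtain ⟨t₀, ht₀, hat₀⟩ := hex
    refine ⟨t₀, fun t ht => ?_⟩
    have := barrier_aux (fun t => - a t) _ t₀ (-(ks - ε))
      (fun t ht => (ha t (hT0.trans (ht₀.trans ht))).fun_neg) (neg_le_neg hat₀) ?_ t ht
    · linarith
    · intro t ht hat
      have hg := hga0 t (hT0.trans (ht₀.trans ht))
      have hbt := hbpos t (hT0.trans (ht₀.trans ht))
      have hat' : a t = ks - ε := by
        linarith
      rw [hat']
      have : 0 < k₁ * b t ^ 2 * (ks - (ks - ε)) := mul_pos (by positivity) (by linarith)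
      linarith
  rw [Metric.tendsto_atTop]
  intro ε hε
  obtain ⟨T₁, h₁⟩ := hupper (ε / 2) (by linarith)
  obtain ⟨T₂, h₂⟩ := hlower (ε / 2) (by linarith)
  refine ⟨max T₁ T₂, fun t ht => ?_⟩
  have h3 := h₁ t ((le_max_left _ _).trans ht)
  have h4 := h₂ t ((le_max_right _ _).trans ht)
  rw [Real.dist_eq, abs_lt]
  constructor <;> linarith
end

section
/- (Higher-order negative slope motif: robustness to unbounded inflow with slow relative growth.) Let k₁, k₂ > 0 and k* = k₂/k₁. Let g_a, g_b : ℝ_{≥0} → ℝ_{≥0} with g(t) := g_a(t) + g_b(t), G(t) := ∫₀ᵗ g(s) ds → ∞ as t → ∞, g_a differentiable, g_a(t) → ∞ as t → ∞, and ġ_a(t)/(g_a(t)^{1/2}·g(t)) → 0 as t → ∞. Let a, b : [0,∞) → ℝ_{>0} be differentiable with (a(0), b(0)) in the open positive quadrant, satisfying ȧ(t) = k₁·b(t)²·(k* − a(t)) + g_a(t) and ḃ(t) = −k₁·b(t)²·(k* − a(t)) + g_b(t). Then a(t) → k* as t → ∞. -/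
open Filter MeasureTheory Topology

lemma trap_aux (f f' : ℝ → ℝ) (c : ℝ) (hc : 0 < c)
    (hd : ∀ᶠ t in atTop, HasDerivAt f (f' t) t)
    (hneg : ∀ᶠ t in atTop, 0 ≤ f t → f' t ≤ -c) :
    ∀ᶠ t in atTop, f t ≤ 0 := by
  obtain ⟨T, hT⟩ := eventually_atTop.1 (hd.and hneg)
  have hex : ∃ t₀ ≥ T, f t₀ ≤ 0 := by
    by_contra! hcon
    have h := image_le_of_deriv_right_le_deriv_boundary (f := f) (f' := f')
      (a := T) (b := T + f T / c) (B := fun x => f T - c * (x - T)) (B' := fun _ => -c)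
      (fun x hx => (hT x hx.1).1.continuousAt.continuousWithinAt)
      (fun x hx => (hT x hx.1).1.hasDerivWithinAt)
      (by simp)
      (by fun_prop)
      (fun x hx => by
        have : HasDerivAt (fun x => f T - c * (x - T)) (-c) x := by
          simpa using (((hasDerivAt_id x).sub_const T).const_mul c).const_sub (f T)
        exact this.hasDerivWithinAt)
      (fun x hx => (hT x hx.1).2 (hcon x hx.1).le)
    have hfT := hcon T le_rfl
    have hle : T ≤ T + f T / c := by
      have : 0 < f T / c := by positivity
      linarith
    have h1 := h (Set.right_mem_Icc.2 hle)
    have h2 := hcon _ hle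
    have h3 : f T - c * (T + f T / c - T) = 0 := by field_simp; ring
    simp only [h3] at h1
    linarith
  obtain ⟨t₀, ht₀, hf₀⟩ := hex
  filter_upwards [eventually_ge_atTop t₀] with t ht
  exact image_le_of_deriv_right_lt_deriv_boundary (f := f) (f' := f')
      (a := t₀) (b := t) (B := fun _ => 0) (B' := fun _ => 0)
      (fun x hx => (hT x (ht₀.le.trans hx.1)).1.continuousAt.continuousWithinAt)
      (fun x hx => (hT x (ht₀.le.trans hx.1)).1.hasDerivWithinAt)
      hf₀ (fun x => hasDerivAt_const x (0:ℝ))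
      (fun x hx hx0 => by
        have := (hT x (ht₀.le.trans hx.1)).2 hx0.ge
        linarith) (Set.right_mem_Icc.2 ht)

/-- Higher-order negative slope motif, unbounded inflow with slow
relative growth: for `ȧ = k₁b²(k* − a) + g_a(t)`, `ḃ = −k₁b²(k* − a) + g_b(t)` with
`k* = k₂/k₁`, `g = g_a + g_b`, `G(t) = ∫₀ᵗ g → ∞`, `g_a(t) → ∞` and
`g_a'(t)/(√(g_a(t))·g(t)) → 0`, every positive solution satisfies `a(t) → k*`. -/
theorem stmt15 (k₁ k₂ ks : ℝ) (hk₁ : 0 < k₁) (hk₂ : 0 < k₂) (hks : ks = k₂ / k₁)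
    (ga gb ga' : ℝ → ℝ)
    (hga0 : ∀ t ≥ (0:ℝ), 0 ≤ ga t) (hgb0 : ∀ t ≥ (0:ℝ), 0 ≤ gb t)
    (hgadiff : ∀ t ≥ (0:ℝ), HasDerivAt ga (ga' t) t)
    (G : ℝ → ℝ) (hG : ∀ t, G t = ∫ s in (0:ℝ)..t, (ga s + gb s))
    (hGtop : Tendsto G atTop atTop)
    (hgatop : Tendsto ga atTop atTop)
    (hslow : Tendsto (fun t => ga' t / (Real.sqrt (ga t) * (ga t + gb t)))
      atTop (𝓝 0))
    (a b : ℝ → ℝ)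
    (hapos : ∀ t ≥ (0:ℝ), 0 < a t) (hbpos : ∀ t ≥ (0:ℝ), 0 < b t)
    (ha : ∀ t ≥ (0:ℝ), HasDerivAt a (k₁ * (b t) ^ 2 * (ks - a t) + ga t) t)
    (hb : ∀ t ≥ (0:ℝ), HasDerivAt b (-(k₁ * (b t) ^ 2 * (ks - a t)) + gb t) t) :
    Tendsto a atTop (𝓝 ks) := by
  have h0 := eventually_ge_atTop (0:ℝ)
  have hg1 := hgatop.eventually_ge_atTop 1
  have hsd : ∀ t ≥ (0:ℝ), HasDerivAt (fun t => a t + b t) (ga t + gb t) t := by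
    intro t ht
    exact ((ha t ht).add (hb t ht)).congr_deriv (by ring)
  have hs : ∀ M : ℝ, ∀ᶠ t in atTop, M ≤ a t + b t := by
    intro M
    have := trap_aux (fun t => M - (a t + b t)) (fun t => -(ga t + gb t)) 1 one_pos
      (by filter_upwards [h0] with t ht using (hsd t ht).const_sub M)
      (by
        filter_upwards [h0, hg1] with t ht h1 _
        have := hgb0 t ht
        linarith)
    filter_upwards [this] with t ht
    linarith
  have hsq : ∀ ε > 0, ∀ᶠ t in atTop, Real.sqrt (ga t) ≤ ε * (a t + b t) := by
    intro ε hε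
    have := trap_aux (fun t => Real.sqrt (ga t) - ε * (a t + b t))
      (fun t => ga' t / (2 * Real.sqrt (ga t)) - ε * (ga t + gb t)) (ε / 2) (by positivity)
      (by
        filter_upwards [h0, hg1] with t ht h1
        exact ((hgadiff t ht).sqrt (by linarith)).sub ((hsd t ht).const_mul ε))
      (by
        filter_upwards [h0, hg1, hslow.eventually_le_const hε] with t ht h1 h2 _
        have h3 := hgb0 t ht
        have h4 : 0 < Real.sqrt (ga t) := Real.sqrt_pos.2 (by linarith)
        have h5 : 0 < ga t + gb t := by linarith
        rw [div_le_iff₀ (by positivity)] at h2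
        have h6 : ga' t / (2 * Real.sqrt (ga t)) ≤ ε * (ga t + gb t) / 2 := by
          rw [div_le_iff₀ (by positivity)]
          linarith
        nlinarith)
    filter_upwards [this] with t ht
    linarith
  have hgs : ∀ ε > 0, ∀ᶠ t in atTop, ga t ≤ ε * (a t + b t) ^ 2 := by
    intro ε hε
    filter_upwards [h0, hsq (Real.sqrt ε) (Real.sqrt_pos.2 hε)] with t ht h1
    have h2 := Real.sq_sqrt (hga0 t ht)
    have h3 := Real.sq_sqrt hε.le
    calc ga t = Real.sqrt (ga t) ^ 2 := h2.symm
      _ ≤ (Real.sqrt ε * (a t + b t)) ^ 2 := by gcongr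
      _ = ε * (a t + b t) ^ 2 := by rw [mul_pow, h3]
  have hbs : ∀ᶠ t in atTop, (a t + b t) / 2 ≤ b t := by
    have := trap_aux (fun t => (b t)⁻¹ - 2 * (a t + b t)⁻¹)
      (fun t => -(-(k₁ * (b t) ^ 2 * (ks - a t)) + gb t) / (b t) ^ 2
        - 2 * (-(ga t + gb t) / (a t + b t) ^ 2)) 1 one_pos
      (by
        filter_upwards [h0] with t ht
        have h1 := hapos t ht
        have h2 := hbpos t ht
        exact ((hb t ht).inv h2.ne').sub (((hsd t ht).inv (by positivity)).const_mul 2))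
      (by
        filter_upwards [h0, hgs 1 one_pos, hs (2 * (ks + 3 / k₁))] with t ht h1 h2 h3
        have pa := hapos t ht
        have pb := hbpos t ht
        have pg := hgb0 t ht
        have h4 : 2 * b t ≤ a t + b t := by
          have h5 : 2 * (a t + b t)⁻¹ ≤ (b t)⁻¹ := by linarith
          rw [← div_eq_mul_inv, div_le_iff₀ (by positivity), inv_mul_eq_div,
            le_div_iff₀ pb] at h5
          exact h5
        have e1 : -(-(k₁ * (b t) ^ 2 * (ks - a t)) + gb t) / (b t) ^ 2
            = -(k₁ * (a t - ks)) - gb t / (b t) ^ 2 := by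
          field_simp
          ring
        have e2 : -(ga t + gb t) / (a t + b t) ^ 2
            = -(ga t / (a t + b t) ^ 2) - gb t / (a t + b t) ^ 2 := by
          ring
        have e3 : ga t / (a t + b t) ^ 2 ≤ 1 := by
          rw [div_le_iff₀ (by positivity)]
          exact h1
        have e4 : 2 * (gb t / (a t + b t) ^ 2) ≤ gb t / (b t) ^ 2 := by
          rw [← mul_div_assoc, div_le_div_iff₀ (by positivity) (by positivity)]
          have : 2 * b t ^ 2 ≤ (a t + b t) ^ 2 := by nlinarith
          nlinarith
        have e5 : 3 ≤ k₁ * (a t - ks) := by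
          have : 3 / k₁ ≤ a t - ks := by linarith
          rw [div_le_iff₀ hk₁] at this
          linarith
        rw [e1, e2]
        linarith)
    filter_upwards [this, h0] with t h1 ht
    have pa := hapos t ht
    have pb := hbpos t ht
    have h5 : (b t)⁻¹ ≤ 2 * (a t + b t)⁻¹ := by linarith
    rw [← div_eq_mul_inv, le_div_iff₀ (by positivity), inv_mul_eq_div,
      div_le_iff₀ pb] at h5
    linarith
  have hlow : ∀ δ > 0, ∀ᶠ t in atTop, ks - δ ≤ a t := by
    intro δ hδ
    have := trap_aux (fun t => (ks - δ) - a t)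
      (fun t => -(k₁ * (b t) ^ 2 * (ks - a t) + ga t)) 1 one_pos
      (by filter_upwards [h0] with t ht using (ha t ht).const_sub _)
      (by
        filter_upwards [hg1] with t h1 h2
        have : 0 ≤ k₁ * (b t) ^ 2 * (ks - a t) :=
          mul_nonneg (by positivity) (by linarith)
        linarith)
    filter_upwards [this] with t ht
    linarith
  have hup : ∀ δ > 0, ∀ᶠ t in atTop, a t ≤ ks + δ := by
    intro δ hδ
    have := trap_aux (fun t => a t - (ks + δ))
      (fun t => k₁ * (b t) ^ 2 * (ks - a t) + ga t) 1 one_pos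
      (by filter_upwards [h0] with t ht using (ha t ht).sub_const _)
      (by
        filter_upwards [h0, hg1, hbs, hgs (k₁ * δ / 8) (by positivity)] with t ht h1 h2 h3 h4
        have pa := hapos t ht
        have pb := hbpos t ht
        have h5 : ((a t + b t) / 2) ^ 2 ≤ b t ^ 2 := by gcongr
        have h6 : k₁ * (b t) ^ 2 * δ ≤ k₁ * (b t) ^ 2 * (a t - ks) :=
          mul_le_mul_of_nonneg_left (by linarith) (by positivity)
        have h7 : k₁ * δ * ((a t + b t) / 2) ^ 2 ≤ k₁ * δ * b t ^ 2 :=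
          mul_le_mul_of_nonneg_left h5 (by positivity)
        have e1 : k₁ * (b t) ^ 2 * (ks - a t) = -(k₁ * (b t) ^ 2 * (a t - ks)) := by ring
        have e2 : k₁ * δ * ((a t + b t) / 2) ^ 2 = 2 * (k₁ * δ / 8 * (a t + b t) ^ 2) := by ring
        linarith)
    filter_upwards [this] with t ht
    linarith
  rw [Metric.tendsto_nhds]
  intro ε hε
  filter_upwards [hlow (ε / 2) (by positivity), hup (ε / 2) (by positivity)] with t h1 h2
  rw [Real.dist_eq, abs_lt]
  constructor <;> linarith
end

section
/- (Zero slope motif with time-dependent inflows.) Let k₁, k₂ > 0 and k* = k₂/k₁. Let g_a, g_b : ℝ_{≥0} → ℝ_{≥0}, and let a, b : [0,∞) → ℝ_{≥0} be differentiable satisfying ȧ(t) = k₁·b(t)·(k* − a(t)) + g_a(t) and ḃ(t) = g_b(t). Assume ∫₀ᵗ b(s) ds → ∞ as t → ∞ and that the limit L := lim_{t→∞} g_a(t)/(b(0) + ∫₀ᵗ g_b(s) ds) exists and is finite. Then a(t) → k* + L/k₁ as t → ∞. -/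
open Filter MeasureTheory Topology

theorem aux_upper (k ε T : ℝ) (hk : 0 < k) (hε : 0 < ε) (u u' b B : ℝ → ℝ)
    (hu : ∀ t ≥ T, HasDerivAt u (u' t) t) (hB : ∀ t ≥ T, HasDerivAt B (b t) t)
    (hle : ∀ t ≥ T, u' t ≤ - (k * b t * u t) + ε * (k * b t))
    (hBt : Tendsto B atTop atTop) : ∀ᶠ t in atTop, u t < 2 * ε := by
  have hd : ∀ t ≥ T, HasDerivAt (fun t => (u t - ε) * Real.exp (k * B t))
      (u' t * Real.exp (k * B t) + (u t - ε) * (Real.exp (k * B t) * (k * b t))) t := by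
    intro t ht
    exact ((hu t ht).sub_const ε).mul (((hB t ht).const_mul k).exp)
  have hanti : AntitoneOn (fun t => (u t - ε) * Real.exp (k * B t)) (Set.Ici T) := by
    apply antitoneOn_of_deriv_nonpos (convex_Ici T)
    · intro t ht
      exact (hd t ht).continuousAt.continuousWithinAt
    · intro t ht
      rw [interior_Ici] at ht
      exact (hd t (le_of_lt ht)).differentiableAt.differentiableWithinAt
    · intro t ht
      rw [interior_Ici] at ht
      rw [(hd t (le_of_lt ht)).deriv]
      have h1 := hle t (le_of_lt ht)
      have h2 := Real.exp_pos (k * B t)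
      have h3 : Real.exp (k * B t) * (u' t + (u t - ε) * (k * b t)) ≤ 0 :=
        mul_nonpos_of_nonneg_of_nonpos h2.le (by nlinarith)
      nlinarith
  have hE : Tendsto (fun t => ε * Real.exp (k * B t)) atTop atTop :=
    (Real.tendsto_exp_atTop.comp (hBt.const_mul_atTop hk)).const_mul_atTop hε
  filter_upwards [hE.eventually_gt_atTop ((u T - ε) * Real.exp (k * B T)),
    eventually_ge_atTop T] with t h1 h2
  have h3 : (u t - ε) * Real.exp (k * B t) ≤ (u T - ε) * Real.exp (k * B T) :=
    hanti (Set.mem_Ici.2 le_rfl) h2 h2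
  have h4 : u t - ε < ε := lt_of_mul_lt_mul_right (h3.trans_lt h1) (Real.exp_pos _).le
  linarith

/-- Zero slope motif with time-dependent inflows: for
`ȧ = k₁b(k* − a) + g_a(t)`, `ḃ = g_b(t)` with `k* = k₂/k₁`, if `∫₀ᵗ b → ∞` and
`L = lim_{t→∞} g_a(t)/(b(0) + ∫₀ᵗ g_b)` exists and is finite, then
`a(t) → k* + L/k₁`. -/
theorem stmt16 (k₁ k₂ ks : ℝ) (hk₁ : 0 < k₁) (hk₂ : 0 < k₂) (hks : ks = k₂ / k₁)
    (ga gb : ℝ → ℝ)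
    (hga0 : ∀ t ≥ (0:ℝ), 0 ≤ ga t) (hgb0 : ∀ t ≥ (0:ℝ), 0 ≤ gb t)
    (a b : ℝ → ℝ)
    (hanneg : ∀ t ≥ (0:ℝ), 0 ≤ a t) (hbnneg : ∀ t ≥ (0:ℝ), 0 ≤ b t)
    (ha : ∀ t ≥ (0:ℝ), HasDerivAt a (k₁ * b t * (ks - a t) + ga t) t)
    (hb : ∀ t ≥ (0:ℝ), HasDerivAt b (gb t) t)
    (hbint : Tendsto (fun T => ∫ s in (0:ℝ)..T, b s) atTop atTop)
    (L : ℝ)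
    (hL : Tendsto (fun t => ga t / (b 0 + ∫ s in (0:ℝ)..t, gb s)) atTop (𝓝 L)) :
    Tendsto a atTop (𝓝 (ks + L / k₁)) := by
  have hbc : ContinuousOn b (Set.Ici 0) := fun t ht => (hb t ht).continuousAt.continuousWithinAt
  have hbeq : ∀ t ≥ (0:ℝ), b 0 + ∫ s in (0:ℝ)..t, gb s = b t := by
    intro t ht
    have hc : ContinuousOn b (Set.uIcc 0 t) := by
      rw [Set.uIcc_of_le ht]
      exact hbc.mono Set.Icc_subset_Ici_self
    have hI : IntervalIntegrable gb volume 0 t := by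
      apply intervalIntegral.intervalIntegrable_deriv_of_nonneg hc
      · intro x hx
        rw [min_eq_left ht] at hx
        exact hb x hx.1.le
      · intro x hx
        rw [min_eq_left ht] at hx
        exact hgb0 x hx.1.le
    rw [intervalIntegral.integral_eq_sub_of_hasDerivAt (f := b) _ hI]
    · ring
    · intro x hx
      rw [Set.uIcc_of_le ht] at hx
      exact hb x hx.1
  have hmono : MonotoneOn b (Set.Ici 0) := by
    apply monotoneOn_of_deriv_nonneg (convex_Ici 0) hbc
    · intro t ht
      rw [interior_Ici] at ht
      exact (hb t (le_of_lt ht)).differentiableAt.differentiableWithinAt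
    · intro t ht
      rw [interior_Ici] at ht
      rw [(hb t (le_of_lt ht)).deriv]
      exact hgb0 t (le_of_lt ht)
  have hpos : ∃ T₀ ≥ (0:ℝ), 0 < b T₀ := by
    by_contra! hcon
    obtain ⟨T, h1, h2⟩ := ((hbint.eventually_gt_atTop 0).and (eventually_ge_atTop 0)).exists
    have h3 : ∫ s in (0:ℝ)..T, b s ≤ 0 := by
      rw [intervalIntegral.integral_of_le h2]
      exact setIntegral_nonpos measurableSet_Ioc fun x hx => hcon x hx.1.le
    linarith
  obtain ⟨T₀, hT₀, hbT₀⟩ := hpos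
  have hB : ∀ t > (0:ℝ), HasDerivAt (fun T => ∫ s in (0:ℝ)..T, b s) (b t) t := by
    intro t ht
    apply intervalIntegral.integral_hasDerivAt_right
    · apply ContinuousOn.intervalIntegrable
      rw [Set.uIcc_of_le ht.le]
      exact hbc.mono Set.Icc_subset_Ici_self
    · exact (hbc.mono Set.Ioi_subset_Ici_self).stronglyMeasurableAtFilter isOpen_Ioi t ht
    · exact (hb t ht.le).continuousAt
  have hkey : ∀ ε > 0, ∃ T > (0:ℝ), ∀ t ≥ T, |ga t - L * b t| ≤ ε * (k₁ * b t) := by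
    intro ε hε
    have h1 := (Metric.tendsto_nhds.1 hL) (ε * k₁) (by positivity)
    obtain ⟨T, hT⟩ := eventually_atTop.1 h1
    refine ⟨max T (max T₀ 1), by positivity, fun t ht => ?_⟩
    have ht1 : T ≤ t := (le_max_left _ _).trans ht
    have ht2 : T₀ ≤ t := (le_max_left _ _).trans ((le_max_right _ _).trans ht)
    have ht0 : 0 ≤ t := hT₀.le.trans ht2
    have h2 := hT t ht1
    have hbt : 0 < b t := hbT₀.trans_le (hmono hT₀ ht0 ht2)
    rw [hbeq t ht0, Real.dist_eq] at h2
    have h3 : ga t - L * b t = (ga t / b t - L) * b t := by field_simp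
    rw [h3, abs_mul, abs_of_pos hbt]
    nlinarith
  rw [Metric.tendsto_nhds]
  intro ε hε
  obtain ⟨T, hT0, hT⟩ := hkey (ε / 2) (by positivity)
  have hup := aux_upper k₁ (ε / 2) T hk₁ (by positivity) (fun t => a t - (ks + L / k₁))
    _ b _ (fun t ht => (ha t (hT0.le.trans ht)).sub_const _)
    (fun t ht => hB t (hT0.trans_le ht)) (fun t ht => by
      have h := (abs_le.1 (hT t ht)).2
      have h2 : k₁ * b t * (L / k₁) = L * b t := by field_simp
      linarith) hbint
  have hlo := aux_upper k₁ (ε / 2) T hk₁ (by positivity) (fun t => -(a t - (ks + L / k₁)))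
    _ b _ (fun t ht => ((ha t (hT0.le.trans ht)).sub_const _).neg)
    (fun t ht => hB t (hT0.trans_le ht)) (fun t ht => by
      have h := (abs_le.1 (hT t ht)).1
      have h2 : k₁ * b t * (L / k₁) = L * b t := by field_simp
      linarith) hbint
  filter_upwards [hup, hlo] with t h1 h2
  rw [Real.dist_eq, abs_lt]
  constructor <;> linarith
end

section
/- (Bifunctional enzyme network with inflow of complex.) Let k₁, k₂, k₃, k₄ > 0 and let g_x, g_y, g_e ≥ 0 and g_c > 0 be constants. Let x, y, e, c : [0,∞) → ℝ_{≥0} be differentiable and satisfy ẋ = −k₁xe + k₂c + k₄cy + g_x, ẏ = k₃c − k₄cy + g_y, ė = −k₁xe + (k₂+k₃)c + g_e, ċ = k₁xe − (k₂+k₃)c + g_c. Then y(t) → k₃/k₄ as t → ∞. -/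
open Filter MeasureTheory Topology

/-- Barrier lemma: if `f` grows at rate at least `δ > 0` whenever `f ≤ A`, then eventually `A ≤ f`. -/
theorem eventually_ge_of_barrier (f f' : ℝ → ℝ) (T A δ : ℝ) (hδ : 0 < δ)
    (hf : ∀ t ≥ T, HasDerivAt f (f' t) t)
    (hb : ∀ t ≥ T, f t ≤ A → δ ≤ f' t) :
    ∃ S ≥ T, ∀ t ≥ S, A ≤ f t := by
  have h1 : ∃ S ≥ T, A ≤ f S := by
    by_contra! hcon
    have hlow : ∀ t ≥ T, f T + δ * (t - T) ≤ f t := by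
      intro t ht
      have := image_le_of_deriv_right_le_deriv_boundary
        (f := fun s => f T + δ * (s - T)) (f' := fun _ => δ) (a := T) (b := t)
        (B := f) (B' := f')
        (by fun_prop)
        (fun s _ => by
          have := (((hasDerivAt_id s).sub_const T).const_mul δ).const_add (f T)
          simpa using this.hasDerivWithinAt)
        (by simp)
        (fun s hs => (hf s hs.1).continuousAt.continuousWithinAt)
        (fun s hs => (hf s hs.1).hasDerivWithinAt)
        (fun s hs => hb s hs.1 (hcon s hs.1).le)
      exact this ⟨ht, le_rfl⟩
    have hTA := hcon T le_rfl
    have hq : 0 ≤ (A - f T) / δ := div_nonneg (by linarith) hδ.le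
    have h2 := hlow (T + (A - f T) / δ) (by linarith)
    have h3 := hcon (T + (A - f T) / δ) (by linarith)
    have h4 : δ * (T + (A - f T) / δ - T) = A - f T := by field_simp; ring
    linarith
  obtain ⟨S, hST, hS⟩ := h1
  refine ⟨S, hST, fun t ht => ?_⟩
  have := image_le_of_deriv_right_lt_deriv_boundary'
    (f := fun _ => A) (f' := fun _ => 0) (a := S) (b := t)
    (B := f) (B' := f')
    (by fun_prop)
    (fun s _ => hasDerivWithinAt_const _ _ _)
    hS
    (fun s hs => (hf s (hST.trans hs.1)).continuousAt.continuousWithinAt)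
    (fun s hs => (hf s (hST.trans hs.1)).hasDerivWithinAt)
    (fun s hs h => lt_of_lt_of_le hδ (hb s (hST.trans hs.1) (le_of_eq h.symm)))
  exact this ⟨ht, le_rfl⟩

/-- Bifunctional enzyme network with inflow of complex: for the
mass action system `ẋ = −k₁xe + k₂c + k₄cy + g_x`, `ẏ = k₃c − k₄cy + g_y`,
`ė = −k₁xe + (k₂+k₃)c + g_e`, `ċ = k₁xe − (k₂+k₃)c + g_c` with constant inflows
`g_x, g_y, g_e ≥ 0` and `g_c > 0`, one has `y(t) → k₃/k₄`. -/
theorem stmt17 (k₁ k₂ k₃ k₄ : ℝ)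
    (hk₁ : 0 < k₁) (hk₂ : 0 < k₂) (hk₃ : 0 < k₃) (hk₄ : 0 < k₄)
    (gx gy ge gc : ℝ) (hgx : 0 ≤ gx) (hgy : 0 ≤ gy) (hge : 0 ≤ ge) (hgc : 0 < gc)
    (x y e c : ℝ → ℝ)
    (hxn : ∀ t ≥ (0:ℝ), 0 ≤ x t) (hyn : ∀ t ≥ (0:ℝ), 0 ≤ y t)
    (hen : ∀ t ≥ (0:ℝ), 0 ≤ e t) (hcn : ∀ t ≥ (0:ℝ), 0 ≤ c t)
    (hx : ∀ t ≥ (0:ℝ),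
      HasDerivAt x (-(k₁ * x t * e t) + k₂ * c t + k₄ * c t * y t + gx) t)
    (hy : ∀ t ≥ (0:ℝ), HasDerivAt y (k₃ * c t - k₄ * c t * y t + gy) t)
    (he : ∀ t ≥ (0:ℝ),
      HasDerivAt e (-(k₁ * x t * e t) + (k₂ + k₃) * c t + ge) t)
    (hc : ∀ t ≥ (0:ℝ),
      HasDerivAt c (k₁ * x t * e t - (k₂ + k₃) * c t + gc) t) :
    Tendsto y atTop (𝓝 (k₃ / k₄)) := by
  have hK : 0 < k₂ + k₃ := by linarith
  -- `c` is eventually bounded below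
  obtain ⟨T1, hT1, hc0⟩ := eventually_ge_of_barrier c _ 0 (gc / (2 * (k₂ + k₃))) (gc / 2)
    (by linarith) hc (by
      intro t ht h
      have h1 : 0 ≤ k₁ * x t * e t := mul_nonneg (mul_nonneg hk₁.le (hxn t ht)) (hen t ht)
      have h2 := mul_le_mul_of_nonneg_left h hK.le
      have h3 : (k₂ + k₃) * (gc / (2 * (k₂ + k₃))) = gc / 2 := by field_simp
      linarith)
  have hc0p : 0 < gc / (2 * (k₂ + k₃)) := by positivity
  generalize gc / (2 * (k₂ + k₃)) = c0 at hc0 hc0p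
  have hk34 : k₄ * (k₃ / k₄) = k₃ := by field_simp
  -- upper bounds for `y`
  have yup : ∀ a > 0, ∀ T ≥ (0:ℝ), ∀ ε > 0, k₄ * a * ε = gy + 1 → (∀ t ≥ T, a ≤ c t) →
      ∃ S ≥ T, ∀ t ≥ S, y t ≤ k₃ / k₄ + ε := by
    intro a ha T hT ε hε hae hca
    obtain ⟨S, hS, h⟩ := eventually_ge_of_barrier (fun t => -y t) _ T (-(k₃ / k₄ + ε)) 1
      one_pos (fun t ht => (hy t (le_trans hT ht)).neg) (by
        intro t ht h
        have h1 : ε ≤ y t - k₃ / k₄ := by linarith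
        have h2 : a * ε ≤ c t * (y t - k₃ / k₄) :=
          mul_le_mul (hca t ht) h1 hε.le (ha.le.trans (hca t ht))
        have h3 := mul_le_mul_of_nonneg_left h2 hk₄.le
        have h4 : k₄ * (c t * (y t - k₃ / k₄)) = k₄ * c t * y t - k₃ * c t := by
          linear_combination (-c t) * hk34
        linarith)
    exact ⟨S, hS, fun t ht => by have := h t ht; linarith⟩
  have ylow : ∀ a > 0, ∀ T ≥ (0:ℝ), ∀ ε > 0, k₄ * a * ε = gy + 1 → (∀ t ≥ T, a ≤ c t) →
      ∃ S ≥ T, ∀ t ≥ S, k₃ / k₄ - ε ≤ y t := by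
    intro a ha T hT ε hε hae hca
    exact eventually_ge_of_barrier y _ T (k₃ / k₄ - ε) 1
      one_pos (fun t ht => hy t (le_trans hT ht)) (by
        intro t ht h
        have h1 : ε ≤ k₃ / k₄ - y t := by linarith
        have h2 : a * ε ≤ c t * (k₃ / k₄ - y t) :=
          mul_le_mul (hca t ht) h1 hε.le (ha.le.trans (hca t ht))
        have h3 := mul_le_mul_of_nonneg_left h2 hk₄.le
        have h4 : k₄ * (c t * (k₃ / k₄ - y t)) = k₃ * c t - k₄ * c t * y t := by
          linear_combination (c t) * hk34
        linarith)
  obtain ⟨T2, hT2, hY⟩ := yup c0 hc0p T1 hT1 ((gy + 1) / (k₄ * c0)) (by positivity)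
    (by field_simp) hc0
  generalize k₃ / k₄ + (gy + 1) / (k₄ * c0) = Y at hY
  -- `c` tends to infinity
  have cinf : ∀ A > 0, ∃ S ≥ (0:ℝ), ∀ t ≥ S, A ≤ c t := by
    intro A hA
    obtain ⟨T3, hT3, h3⟩ := eventually_ge_of_barrier (fun t => x t + y t + c t) _ 0
      (A + Y + (k₂ + k₃) * A / k₁) gc hgc
      (fun t ht => ((hx t ht).add (hy t ht)).add (hc t ht))
      (by intro t ht _; linarith)
    obtain ⟨T4, hT4, h4⟩ := eventually_ge_of_barrier (fun t => e t + c t) _ 0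
      (A + 1) gc hgc (fun t ht => (he t ht).add (hc t ht))
      (by intro t ht _; linarith)
    obtain ⟨S, hS, h⟩ := eventually_ge_of_barrier c _ (max T2 (max T3 T4)) A gc hgc
      (fun t ht => hc t (hT3.le.trans ((le_max_left _ _).trans ((le_max_right _ _).trans ht))))
      (by
        intro t ht hcA
        have ht2 : T2 ≤ t := (le_max_left _ _).trans ht
        have ht3 : T3 ≤ t := (le_max_left _ _).trans ((le_max_right _ _).trans ht)
        have ht4 : T4 ≤ t := (le_max_right _ _).trans ((le_max_right _ _).trans ht)
        have a2 := hY t ht2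
        have a3 := h3 t ht3
        have a4 := h4 t ht4
        have b1 : (k₂ + k₃) * A / k₁ ≤ x t := by linarith
        have b2 : 1 ≤ e t := by linarith
        have b3 : (k₂ + k₃) * A ≤ k₁ * x t := by
          rw [div_le_iff₀ hk₁] at b1; linarith
        have b4 : k₁ * x t ≤ k₁ * x t * e t :=
          le_mul_of_one_le_right ((by positivity : 0 ≤ (k₂ + k₃) * A).trans b3) b2
        have b5 := mul_le_mul_of_nonneg_left hcA hK.le
        linarith)
    exact ⟨S, (hT3.le.trans ((le_max_left _ _).trans (le_max_right _ _))).trans hS, h⟩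
  rw [Metric.tendsto_atTop]
  intro ε hε
  have hA : 0 < (gy + 1) / (k₄ * (ε / 2)) := by positivity
  obtain ⟨S, hS, hcS⟩ := cinf _ hA
  have hAe : k₄ * ((gy + 1) / (k₄ * (ε / 2))) * (ε / 2) = gy + 1 := by field_simp
  obtain ⟨S1, _, h1⟩ := yup _ hA S hS (ε / 2) (by linarith) hAe hcS
  obtain ⟨S2, _, h2⟩ := ylow _ hA S hS (ε / 2) (by linarith) hAe hcS
  refine ⟨max S1 S2, fun t ht => ?_⟩
  have a1 := h1 t ((le_max_left _ _).trans ht)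
  have a2 := h2 t ((le_max_right _ _).trans ht)
  rw [Real.dist_eq, abs_lt]
  constructor <;> linarith
end

section
/- (Explicit solution of the closed archetypal ACR system.) Let k₁, k₂ > 0 and k = k₂/k₁, and let (a₀, b₀) ∈ ℝ²_{≥0}. Define b : [0,∞) → ℝ by b(t) = (a₀ + b₀ − k)/(1 + ((a₀ − k)/b₀)·e^{−(a₀+b₀−k)k₁t}) if a₀ + b₀ ≠ k and b₀ > 0, and b(t) = (k − a₀)/(1 + (k − a₀)k₁t) if a₀ + b₀ = k, and set a(t) = a₀ + b₀ − b(t). Then (a(t), b(t)) solves the system ȧ = k₁b(k − a), ḃ = −k₁b(k − a) with initial condition (a(0), b(0)) = (a₀, b₀); moreover, for (a₀, b₀) in the open positive quadrant with a₀ ≠ k, one has ∫₀^∞ b(t) dt = ∞ if and only if a₀ + b₀ ≥ k. -/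
open Filter MeasureTheory Topology

/-- Explicit solution of the closed archetypal ACR system: with
`k = k₂/k₁`, the explicitly defined `b` (piecewise, according to whether
`a₀ + b₀ = k`; the case `a₀ + b₀ ≠ k` needs `b₀ > 0`) and `a = a₀ + b₀ − b` solve
`ȧ = k₁b(k − a)`, `ḃ = −k₁b(k − a)` with `(a(0), b(0)) = (a₀, b₀)`; moreover, for
`(a₀, b₀)` in the open positive quadrant with `a₀ ≠ k`, `∫₀^∞ b(t) dt = ∞` if and
only if `a₀ + b₀ ≥ k`. -/
theorem stmt19 (k₁ k₂ k : ℝ) (hk₁ : 0 < k₁) (hk₂ : 0 < k₂) (hk : k = k₂ / k₁)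
    (a₀ b₀ : ℝ) (ha₀ : 0 ≤ a₀) (hb₀ : 0 ≤ b₀)
    (hcov : a₀ + b₀ = k ∨ 0 < b₀)
    (b a : ℝ → ℝ)
    (hbdef₁ : a₀ + b₀ ≠ k → 0 < b₀ → ∀ t, b t =
      (a₀ + b₀ - k) / (1 + ((a₀ - k) / b₀) * Real.exp (-((a₀ + b₀ - k) * k₁ * t))))
    (hbdef₂ : a₀ + b₀ = k → ∀ t, b t = (k - a₀) / (1 + (k - a₀) * k₁ * t))
    (hadef : ∀ t, a t = a₀ + b₀ - b t) :
    (a 0 = a₀ ∧ b 0 = b₀ ∧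
      ∀ t ≥ (0:ℝ), HasDerivAt a (k₁ * b t * (k - a t)) t ∧
        HasDerivAt b (-(k₁ * b t * (k - a t))) t) ∧
    (0 < a₀ → 0 < b₀ → a₀ ≠ k →
      (Tendsto (fun T => ∫ t in (0:ℝ)..T, b t) atTop atTop ↔ k ≤ a₀ + b₀)) := by
  -- positivity and the derivative of `b`
  have hb0pos : a₀ + b₀ ≠ k → 0 < b₀ := fun h => hcov.resolve_left h
  have hD : a₀ + b₀ ≠ k → ∀ t ≥ (0:ℝ), 0 < (a₀ + b₀ - k) /
      (1 + ((a₀ - k) / b₀) * Real.exp (-((a₀ + b₀ - k) * k₁ * t))) := by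
    intro h t ht
    have hb := hb0pos h
    have e1 : 1 + (a₀ - k) / b₀ = (a₀ + b₀ - k) / b₀ := by field_simp; ring
    rcases lt_or_gt_of_ne h with h1 | h1
    · have hE : 1 ≤ Real.exp (-((a₀ + b₀ - k) * k₁ * t)) := by
        apply Real.one_le_exp
        have : 0 ≤ (k - (a₀ + b₀)) * k₁ * t :=
          mul_nonneg (mul_nonneg (by linarith) hk₁.le) ht
        linarith
      have h2 : (a₀ + b₀ - k) / b₀ < 0 := div_neg_of_neg_of_pos (by linarith) hb
      apply div_pos_of_neg_of_neg (by linarith)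
      nlinarith
    · have hE : Real.exp (-((a₀ + b₀ - k) * k₁ * t)) ≤ 1 := by
        apply Real.exp_le_one_iff.2
        have : 0 ≤ ((a₀ + b₀) - k) * k₁ * t :=
          mul_nonneg (mul_nonneg (by linarith) hk₁.le) ht
        linarith
      have hE0 := Real.exp_pos (-((a₀ + b₀ - k) * k₁ * t))
      have h2 : 0 < (a₀ + b₀ - k) / b₀ := div_pos (by linarith) hb
      apply div_pos (by linarith)
      rcases le_or_gt 0 ((a₀ - k) / b₀) with h3 | h3
      · positivity
      · nlinarith
  have hbpos : 0 < b₀ → ∀ t ≥ (0:ℝ), 0 < b t := by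
    intro hb t ht
    by_cases h : a₀ + b₀ = k
    · rw [hbdef₂ h, ← h]
      have : a₀ + b₀ - a₀ = b₀ := by ring
      rw [this]
      positivity
    · rw [hbdef₁ h hb]
      exact hD h t ht
  have hb' : ∀ t ≥ (0:ℝ), HasDerivAt b (-(k₁ * b t * (k - a t))) t := by
    intro t ht
    by_cases h : a₀ + b₀ = k
    · have hkb : k - a₀ = b₀ := by linarith
      have hfun : b = fun t => b₀ / (1 + b₀ * k₁ * t) := by
        funext t; rw [hbdef₂ h, hkb]
      have hpos : 1 + b₀ * k₁ * t ≠ 0 := by positivity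
      have hd : HasDerivAt (fun t : ℝ => 1 + b₀ * k₁ * t) (b₀ * k₁) t := by
        simpa using ((hasDerivAt_id t).const_mul (b₀ * k₁)).const_add 1
      have h3 := (hasDerivAt_const t b₀).div hd hpos
      rw [hadef, h, hfun]
      refine HasDerivAt.congr_deriv h3 ?_
      beta_reduce
      field_simp
      ring
    · have hb := hb0pos h
      have hfun : b = fun t => (a₀ + b₀ - k) /
          (1 + ((a₀ - k) / b₀) * Real.exp (-((a₀ + b₀ - k) * k₁ * t))) := by
        funext t; rw [hbdef₁ h hb]
      have hpos : 1 + ((a₀ - k) / b₀) * Real.exp (-((a₀ + b₀ - k) * k₁ * t)) ≠ 0 := by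
        intro h0
        have := hD h t ht
        rw [h0] at this
        simp at this
      have hd0 : HasDerivAt (fun t : ℝ => -((a₀ + b₀ - k) * k₁ * t))
          (-((a₀ + b₀ - k) * k₁)) t := by
        have h9 := ((hasDerivAt_id t).const_mul ((a₀ + b₀ - k) * k₁)).neg
        rw [mul_one] at h9
        exact h9
      have hd := (hd0.exp.const_mul ((a₀ - k) / b₀)).const_add 1
      have h3 := (hasDerivAt_const t (a₀ + b₀ - k)).div hd hpos
      rw [hadef, hfun]
      refine HasDerivAt.congr_deriv h3 ?_
      beta_reduce
      generalize Real.exp (-((a₀ + b₀ - k) * k₁ * t)) = E at *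
      generalize (a₀ - k) / b₀ = c at *
      field_simp
      ring
  have hbz : b 0 = b₀ := by
    by_cases h : a₀ + b₀ = k
    · rw [hbdef₂ h]; simp; linarith
    · have hb := hb0pos h
      rw [hbdef₁ h hb]
      have e1 : 1 + (a₀ - k) / b₀ = (a₀ + b₀ - k) / b₀ := by field_simp; ring
      have : a₀ + b₀ - k ≠ 0 := sub_ne_zero.2 h
      simp only [mul_zero, neg_zero, Real.exp_zero, mul_one, e1]
      field_simp
  refine ⟨⟨by rw [hadef, hbz]; ring, hbz, fun t ht => ⟨?_, hb' t ht⟩⟩, ?_⟩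
  · have h := (hb' t ht).const_sub (a₀ + b₀)
    rw [neg_neg] at h
    have hfun : a = fun t => a₀ + b₀ - b t := funext hadef
    rw [← hfun] at h
    exact h
  intro _ hb _
  -- the antiderivative of `b`
  have hint : ∀ T ≥ (0:ℝ), ∫ t in (0:ℝ)..T, b t =
      (a₀ + b₀ - k) * T - Real.log (b T) / k₁ + Real.log b₀ / k₁ := by
    intro T hT
    have hF : ∀ t ∈ Set.uIcc 0 T, HasDerivAt
        (fun t => (a₀ + b₀ - k) * t - Real.log (b t) / k₁) (b t) t := by
      intro t ht
      rw [Set.uIcc_of_le hT] at ht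
      have hp := hbpos hb t ht.1
      have h1 := ((hasDerivAt_id t).const_mul (a₀ + b₀ - k)).sub
        (((hb' t ht.1).log hp.ne').div_const k₁)
      refine HasDerivAt.congr_deriv h1 ?_
      rw [hadef]
      field_simp
      ring
    have hc : ContinuousOn b (Set.uIcc 0 T) := by
      intro t ht
      rw [Set.uIcc_of_le hT] at ht
      exact (hb' t ht.1).continuousAt.continuousWithinAt
    rw [intervalIntegral.integral_eq_sub_of_hasDerivAt hF hc.intervalIntegrable, hbz]
    ring
  have hcongr : (fun T => ∫ t in (0:ℝ)..T, b t) =ᶠ[atTop] fun T =>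
      (a₀ + b₀ - k) * T - Real.log (b T) / k₁ + Real.log b₀ / k₁ := by
    filter_upwards [eventually_ge_atTop (0:ℝ)] with T hT using hint T hT
  rw [tendsto_congr' hcongr]
  constructor
  · intro hT
    by_contra! hlt
    have hne : a₀ + b₀ ≠ k := hlt.ne
    have hc : (a₀ - k) / b₀ < 0 := div_neg_of_neg_of_pos (by linarith) hb
    have hbound : ∀ T ≥ (0:ℝ), (a₀ + b₀ - k) * T - Real.log (b T) / k₁ + Real.log b₀ / k₁ ≤
        -Real.log ((a₀ + b₀ - k) / ((a₀ - k) / b₀)) / k₁ + Real.log b₀ / k₁ := by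
      intro T hT0
      have hp := hD hne T hT0
      have hq : 0 < (a₀ + b₀ - k) / ((a₀ - k) / b₀) :=
        div_pos_of_neg_of_neg (by linarith) hc
      have hle : (a₀ + b₀ - k) / ((a₀ - k) / b₀) * Real.exp ((a₀ + b₀ - k) * k₁ * T) ≤ b T := by
        rw [hbdef₁ hne hb]
        have hE := Real.exp_pos ((a₀ + b₀ - k) * k₁ * T)
        rw [Real.exp_neg] at hp ⊢
        generalize Real.exp ((a₀ + b₀ - k) * k₁ * T) = E at *
        have hs : a₀ + b₀ - k < 0 := by linarith
        generalize a₀ + b₀ - k = s at *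
        generalize (a₀ - k) / b₀ = c at *
        have hden : 1 + c * E⁻¹ < 0 := by
          by_contra! h0
          exact absurd hp (not_lt.2 (div_nonpos_of_nonpos_of_nonneg hs.le h0))
        have e2 : s / c * E = (-s) / (-(c * E⁻¹)) := by
          have := hc.ne
          field_simp
        have e3 : s / (1 + c * E⁻¹) = (-s) / (-(1 + c * E⁻¹)) := by rw [neg_div_neg_eq]
        rw [e2, e3]
        apply div_le_div_of_nonneg_left <;> linarith
      have hlog := Real.log_le_log (by positivity) hle
      rw [Real.log_mul hq.ne' (Real.exp_pos _).ne', Real.log_exp] at hlog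
      have h5 := div_le_div_of_nonneg_right hlog hk₁.le
      rw [add_div] at h5
      have e4 : (a₀ + b₀ - k) * k₁ * T / k₁ = (a₀ + b₀ - k) * T := by field_simp
      rw [e4] at h5
      rw [neg_div]
      linarith
    obtain ⟨T, h1, h2⟩ := ((hT.eventually_gt_atTop
      (-Real.log ((a₀ + b₀ - k) / ((a₀ - k) / b₀)) / k₁ + Real.log b₀ / k₁)).and
      (eventually_ge_atTop (0:ℝ))).exists
    exact absurd (hbound T h2) (not_le.2 h1)
  · intro hle
    apply tendsto_atTop_add_const_right
    by_cases h : a₀ + b₀ = k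
    · have hkb : k - a₀ = b₀ := by linarith
      have h1 : Tendsto (fun T : ℝ => 1 + b₀ * k₁ * T) atTop atTop :=
        tendsto_atTop_add_const_left _ _ (tendsto_id.const_mul_atTop (by positivity))
      have h2 := (tendsto_atTop_add_const_right _ (-Real.log b₀)
        (Real.tendsto_log_atTop.comp h1)).atTop_div_const hk₁
      refine h2.congr' ?_
      filter_upwards [eventually_ge_atTop (0:ℝ)] with T hT
      have hpos : 1 + b₀ * k₁ * T ≠ 0 := by positivity
      rw [hbdef₂ h, hkb, Real.log_div hb.ne' hpos, h]
      simp only [Function.comp]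
      ring
    · have hs : 0 < a₀ + b₀ - k := sub_pos.2 (lt_of_le_of_ne hle (Ne.symm h))
      have h0 : Tendsto (fun T : ℝ => (a₀ + b₀ - k) * k₁ * T) atTop atTop :=
        tendsto_id.const_mul_atTop (by positivity)
      have h1 := ((Real.tendsto_exp_neg_atTop_nhds_zero.comp h0).const_mul
        ((a₀ - k) / b₀)).const_add 1
      have h2 := (tendsto_const_nhds (x := a₀ + b₀ - k)).div h1 (by simp)
      have h3 : Tendsto b atTop (𝓝 (a₀ + b₀ - k)) := by
        rw [funext (hbdef₁ h hb)]
        simp only [mul_zero, add_zero, div_one] at h2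
        exact h2
      have h4 := ((h3.log hs.ne').div_const k₁).neg
      have h5 : Tendsto (fun T : ℝ => (a₀ + b₀ - k) * T) atTop atTop :=
        tendsto_id.const_mul_atTop hs
      simpa only [sub_eq_add_neg] using h5.atTop_add h4
end
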